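/- arXiv:2205.15457 — 7 statements merged into one kernel-verified Lean document; each statement's English description precedes it below -/
import Mathlib

section
/- Let G be a finitely generated countable group with an essentially free, ergodic, nonsingular action on a standard probability space (X,μ), with logarithmic Radon–Nikodym cocycle ω : G × X → ℝ. Assume the action is of type III₁ (its Maharam extension G ↷ X × ℝ is ergodic) and that the Maharam extension is not induced and is cocycle superrigid with countable targets. Let ℝ act on a standard probability space (Y,η) as a nonsingular ergodic flow, and consider the skew product action of G on (X × Y, μ × η) given by g·(x,y) = (g·x, ω(g,x)·y). Then for every countable group Λ, every measurable 1-cocycle Ω : G × (X × Y) → Λ is cohomologous to a cocycle of the form (g,(x,y)) ↦ δ(g)·γ(ω(g,x), y); that is, there exist a group homomorphism δ : G → Λ, a measurable map γ : ℝ × Y → Λ taking values in the centralizer C_Λ(δ(G)) and satisfying γ(s+t, y) = γ(s, t·y)·γ(t, y) for all s,t ∈ ℝ and η-a.e. y, and a measurable map φ : X × Y → Λ, such that for every g ∈ G, Ω(g,(x,y)) = φ(g·x, ω(g,x)·y)⁻¹ · δ(g) · γ(ω(g,x), y) · φ(x,y) for (μ×η)-a.e. (x,y). -/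
open MeasureTheory
open scoped symmDiff

namespace OESuperrigidity

/-- A map into a (typically countable) discrete space is measurable iff all fibers are
measurable sets. -/
def MeasurableDiscrete {X Λ : Type*} [MeasurableSpace X] (f : X → Λ) : Prop :=
  ∀ l : Λ, MeasurableSet {x | f x = l}

/-- `a` defines an action of the group `G`. -/
def IsAction {G X : Type*} [Group G] (a : G → X → X) : Prop :=
  (∀ x, a 1 x = x) ∧ ∀ g h x, a (g * h) x = a g (a h x)

/-- `f` defines an action of the additive group `ℝ` (a flow). -/
def IsFlow {Y : Type*} (f : ℝ → Y → Y) : Prop :=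
  (∀ y, f 0 y = y) ∧ ∀ s t y, f (s + t) y = f s (f t y)

/-- Each map `a g` is measurable and the pushforward of `μ` under it is equivalent to `μ`. -/
def Nonsingular {ι X : Type*} [MeasurableSpace X] (μ : Measure X) (a : ι → X → X) : Prop :=
  ∀ g, Measurable (a g) ∧ μ.map (a g) ≪ μ ∧ μ ≪ μ.map (a g)

/-- Every a.e. invariant measurable set is null or conull. -/
def ErgodicAction {ι X : Type*} [MeasurableSpace X] (μ : Measure X) (a : ι → X → X) : Prop :=
  ∀ S : Set X, MeasurableSet S → (∀ g, μ ((a g '' S) ∆ S) = 0) → μ S = 0 ∨ μ Sᶜ = 0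

/-- The action is essentially free. -/
def EssentiallyFree {G X : Type*} [Group G] [MeasurableSpace X]
    (μ : Measure X) (a : G → X → X) : Prop :=
  ∀ g : G, g ≠ 1 → μ {x | a g x = x} = 0

/-- The action is induced from a proper subgroup `G₀` acting on a positive-measure
`G₀`-invariant set `X₀` such that the translates of `X₀` over a set `R` of representatives of
the left cosets of `G₀` are pairwise disjoint up to null sets and cover `X` up to a null set. -/
def IsInduced {G X : Type*} [Group G] [MeasurableSpace X]
    (μ : Measure X) (a : G → X → X) : Prop :=
  ∃ G₀ : Subgroup G, G₀ ≠ ⊤ ∧ ∃ X₀ : Set X, MeasurableSet X₀ ∧ 0 < μ X₀ ∧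
    (∀ g ∈ G₀, μ ((a g '' X₀) ∆ X₀) = 0) ∧
    ∃ R : Set G, (∀ g : G, ∃! r, r ∈ R ∧ g⁻¹ * r ∈ G₀) ∧
      (R.Pairwise fun r s => μ (a r '' X₀ ∩ a s '' X₀) = 0) ∧
      μ (⋃ r ∈ R, a r '' X₀)ᶜ = 0

/-- The subgroup `H` admits a measurable fundamental domain for its action. -/
def HasFundamentalDomain {G X : Type*} [Group G] [MeasurableSpace X]
    (μ : Measure X) (a : G → X → X) (H : Subgroup G) : Prop :=
  ∃ U : Set X, MeasurableSet U ∧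
    ((H : Set G).Pairwise fun g h => μ (a g '' U ∩ a h '' U) = 0) ∧
    μ (⋃ g ∈ H, a g '' U)ᶜ = 0

/-- A measurable `1`-cocycle for the action `a` with values in the group `Λ`. -/
def IsCocycle {G X Λ : Type*} [Group G] [Group Λ] [MeasurableSpace X]
    (μ : Measure X) (a : G → X → X) (Ω : G → X → Λ) : Prop :=
  (∀ g, MeasurableDiscrete (Ω g)) ∧
    ∀ g h : G, ∀ᵐ x ∂μ, Ω (g * h) x = Ω g (a h x) * Ω h x

/-- The cocycle `Ω` is cohomologous to a group homomorphism. -/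
def CohomologousToHom {G X Λ : Type*} [Group G] [Group Λ] [MeasurableSpace X]
    (μ : Measure X) (a : G → X → X) (Ω : G → X → Λ) : Prop :=
  ∃ δ : G →* Λ, ∃ φ : X → Λ, MeasurableDiscrete φ ∧
    ∀ g : G, ∀ᵐ x ∂μ, Ω g x = (φ (a g x))⁻¹ * δ g * φ x

/-- The action is cocycle superrigid with countable targets. -/
def CocycleSuperrigid {G X : Type*} [Group G] [MeasurableSpace X]
    (μ : Measure X) (a : G → X → X) : Prop :=
  ∀ (Λ : Type) [Group Λ] [Countable Λ], ∀ Ω : G → X → Λ,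
    IsCocycle μ a Ω → CohomologousToHom μ a Ω

/-- `ω` is (a strict version of) the logarithm of the Radon–Nikodym cocycle of the action. -/
def IsLogRNCocycle {G X : Type*} [Group G] [MeasurableSpace X]
    (μ : Measure X) (a : G → X → X) (ω : G → X → ℝ) : Prop :=
  (∀ g, Measurable (ω g)) ∧
    (∀ g h : G, ∀ᵐ x ∂μ, ω (g * h) x = ω g (a h x) + ω h x) ∧
    ∀ g : G, (fun x => ENNReal.ofReal (Real.exp (ω g x))) =ᵐ[μ] (μ.map (a g⁻¹)).rnDeriv μ

/-- The `G`-invariant σ-finite measure `dμ(x) e^{-s} ds` on `X × ℝ` used for the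
Maharam extension. -/
noncomputable def maharamMeasure {X : Type*} [MeasurableSpace X] (μ : Measure X) :
    Measure (X × ℝ) :=
  μ.prod (volume.withDensity fun s => ENNReal.ofReal (Real.exp (-s)))

/-- The Maharam extension `g · (x, s) = (g · x, ω(g, x) + s)`. -/
def maharamAct {G X : Type*} (a : G → X → X) (ω : G → X → ℝ) : G → X × ℝ → X × ℝ :=
  fun g p => (a g p.1, ω g p.1 + p.2)

end OESuperrigidity

namespace OESuperrigidity

open MeasureTheory

section Aux

theorem aux_choice {Z Λ : Type*} [MeasurableSpace Z] [MeasurableSpace Λ] [DiscreteMeasurableSpace Λ]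
    [Countable Λ] (R : Λ → Set Z) (hR : ∀ l, MeasurableSet (R l)) (d : Λ)
    (hd : ∀ l l' z, z ∈ R l → z ∈ R l' → l = l') :
    ∃ F : Z → Λ, Measurable F ∧ (∀ l z, z ∈ R l → F z = l) ∧ ∀ z, (∀ l, z ∉ R l) → F z = d := by
  classical
  let F : Z → Λ := fun z => if h : ∃ l, z ∈ R l then h.choose else d
  have h1 : ∀ l z, z ∈ R l → F z = l := by
    intro l z hz
    have h : ∃ l, z ∈ R l := ⟨l, hz⟩
    simp only [F, dif_pos h]
    exact hd _ _ _ h.choose_spec hz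
  have h2 : ∀ z, (∀ l, z ∉ R l) → F z = d := by
    intro z hz
    have h : ¬ ∃ l, z ∈ R l := by push Not; exact hz
    simp only [F, dif_neg h]
  refine ⟨F, ?_, h1, h2⟩
  refine measurable_to_countable' fun l => ?_
  have : F ⁻¹' {l} = R l ∪ ({z | l = d} ∩ ⋂ l', (R l')ᶜ) := by
    ext z
    simp only [Set.mem_preimage, Set.mem_singleton_iff, Set.mem_union, Set.mem_inter_iff,
      Set.mem_iInter, Set.mem_compl_iff, Set.mem_ofPred_eq]
    constructor
    · intro hz
      by_cases h : ∃ l, z ∈ R l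
      · obtain ⟨l', hl'⟩ := h
        left
        rw [← hz, h1 _ _ hl']; exact hl'
      · push Not at h
        right
        exact ⟨by rw [← hz, h2 _ h], h⟩
    · rintro (h | ⟨rfl, h⟩)
      · exact h1 _ _ h
      · exact h2 _ h
  rw [this]
  exact (hR l).union ((MeasurableSet.const _).inter (MeasurableSet.iInter fun l' => (hR l').compl))

theorem aux_section {Y C ι : Type*} [MeasurableSpace Y] [StandardBorelSpace Y]
    [MeasurableSpace C] [StandardBorelSpace C] [Nonempty C] [Countable ι] [Nonempty ι]
    (S : ι → Set (Y × C))
    (hS : ∀ k, MeasurableSet (S k)) (hinj : ∀ k, Set.InjOn Prod.fst (S k)) :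
    MeasurableSet (Prod.fst '' ⋃ k, S k) ∧ ∃ σ : Y → C, Measurable σ ∧
      ∀ y ∈ Prod.fst '' ⋃ k, S k, (y, σ y) ∈ ⋃ k, S k := by
  classical
  obtain ⟨e, he⟩ := exists_surjective_nat ι
  rw [← he.iUnion_comp]
  set S' : ℕ → Set (Y × C) := fun k => S (e k) with hS'
  let B : ℕ → Set Y := fun k => Prod.fst '' S' k
  have hB : ∀ k, MeasurableSet (B k) := fun k =>
    (hS (e k)).image_of_measurable_injOn measurable_fst (hinj (e k))
  let T : Set (Y × C) := ⋃ k, S' k ∩ Prod.fst ⁻¹' (disjointed B k)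
  have hT : MeasurableSet T := MeasurableSet.iUnion fun k =>
    (hS (e k)).inter (measurable_fst (MeasurableSet.disjointed hB k))
  have hTinj : Set.InjOn Prod.fst T := by
    rintro p hp q hq hpq
    simp only [T, Set.mem_iUnion] at hp hq
    obtain ⟨i, hi1, hi2⟩ := hp
    obtain ⟨j, hj1, hj2⟩ := hq
    have hij : i = j := by
      by_contra hne
      have := disjoint_disjointed B hne
      refine Set.disjoint_left.1 this hi2 ?_
      simp only [Set.mem_preimage] at hj2
      rw [hpq]; exact hj2
    subst hij
    exact hinj _ hi1 hj1 hpq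
  have hTS : T ⊆ ⋃ k, S' k := Set.iUnion_mono fun k => Set.inter_subset_left
  have himg : Prod.fst '' (⋃ k, S' k) = Prod.fst '' T := by
    refine Set.Subset.antisymm ?_ (Set.image_mono hTS)
    rw [Set.image_iUnion]
    have h1 : (⋃ k, B k) = ⋃ k, disjointed B k := (iUnion_disjointed).symm
    change (⋃ k, B k) ⊆ _
    rw [h1]
    intro y hy
    obtain ⟨k, hk⟩ := Set.mem_iUnion.1 hy
    obtain ⟨p, hp, rfl⟩ := disjointed_subset B k hk
    exact ⟨p, Set.mem_iUnion.2 ⟨k, hp, hk⟩, rfl⟩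
  have hTm : ∀ E : Set C, MeasurableSet E → MeasurableSet (Prod.fst '' (T ∩ Prod.snd ⁻¹' E)) :=
    fun E hE => (hT.inter (measurable_snd hE)).image_of_measurable_injOn measurable_fst
      (hTinj.mono Set.inter_subset_left)
  rw [himg]
  have hTm0 : MeasurableSet (Prod.fst '' T) := hT.image_of_measurable_injOn measurable_fst hTinj
  refine ⟨hTm0, ?_⟩
  let σ : Y → C := fun y => if h : ∃ c, (y, c) ∈ T then h.choose else Classical.arbitrary C
  have hσ1 : ∀ y c, (y, c) ∈ T → σ y = c := by
    intro y c hy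
    have h : ∃ c, (y, c) ∈ T := ⟨c, hy⟩
    simp only [σ, dif_pos h]
    exact congrArg Prod.snd (hTinj h.choose_spec hy rfl)
  have hσ2 : ∀ y, y ∉ Prod.fst '' T → σ y = Classical.arbitrary C := by
    intro y hy
    have h : ¬ ∃ c, (y, c) ∈ T := by
      rintro ⟨c, hc⟩
      exact hy ⟨_, hc, rfl⟩
    simp only [σ, dif_neg h]
  refine ⟨σ, ?_, ?_⟩
  · intro E hE
    have : σ ⁻¹' E = (Prod.fst '' (T ∩ Prod.snd ⁻¹' E)) ∪
        ((Prod.fst '' T)ᶜ ∩ {y | Classical.arbitrary C ∈ E}) := by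
      ext y
      constructor
      · intro hy
        by_cases h : y ∈ Prod.fst '' T
        · obtain ⟨⟨y, c⟩, hc, rfl⟩ := h
          left
          refine ⟨(y, c), ⟨hc, ?_⟩, rfl⟩
          have := hσ1 y c hc
          simpa [this] using hy
        · right
          refine ⟨h, ?_⟩
          have := hσ2 y h
          simpa [this] using hy
      · rintro (⟨⟨y, c⟩, ⟨hc, hcE⟩, rfl⟩ | ⟨h, h'⟩)
        · have := hσ1 y c hc
          simpa [this] using hcE
        · have := hσ2 y h
          simpa [this] using h'
    rw [this]
    exact (hTm E hE).union (hTm0.compl.inter (MeasurableSet.const _))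
  · rintro _ ⟨⟨y, c⟩, hc, rfl⟩
    have := hσ1 y c hc
    simp only [this]
    exact hTS hc

theorem aux_code {P Λ : Type*} [MeasurableSpace P] [StandardBorelSpace P] (m : Measure P)
    [IsFiniteMeasure m] [MeasurableSpace Λ] [DiscreteMeasurableSpace Λ] [Countable Λ] [Nonempty Λ] :
    ∃ (D : (Λ → ℕ → ℕ) × P → Λ) (K : Set (Λ → ℕ → ℕ)), Measurable D ∧ MeasurableSet K ∧
      (∀ φ : P → Λ, Measurable φ → ∃ c ∈ K, ∀ᵐ p ∂m, D (c, p) = φ p) ∧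
      (∀ c ∈ K, ∀ c' ∈ K, (∀ᵐ p ∂m, D (c, p) = D (c', p)) → c = c') := by
  classical
  obtain ⟨𝒜, h𝒜c, h𝒜⟩ := exists_countable_measureDense m
  obtain ⟨A, hA⟩ := h𝒜c.exists_eq_range h𝒜.nonempty
  have hAm : ∀ n, MeasurableSet (A n) := fun n => h𝒜.measurable _ (hA ▸ Set.mem_range_self n)
  have hAd : ∀ E, MeasurableSet E → ∀ ε : ℝ, 0 < ε → ∃ n, m (E ∆ A n) < ENNReal.ofReal ε := by
    intro E hE ε hε
    obtain ⟨t, ht, h⟩ := h𝒜.approx E hE (measure_ne_top _ _) ε hε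
    rw [hA] at ht
    obtain ⟨n, rfl⟩ := ht
    exact ⟨n, h⟩
  let U : Λ → Set ((Λ → ℕ → ℕ) × P) := fun l => {z | ∃ᶠ k in Filter.atTop, z.2 ∈ A (z.1 l k)}
  have hA1 : ∀ l k, MeasurableSet {z : (Λ → ℕ → ℕ) × P | z.2 ∈ A (z.1 l k)} := by
    intro l k
    have : {z : (Λ → ℕ → ℕ) × P | z.2 ∈ A (z.1 l k)} =
        ⋃ n, {z : (Λ → ℕ → ℕ) × P | z.1 l k = n} ∩ Prod.snd ⁻¹' (A n) := by
      ext z; simp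
    rw [this]
    refine MeasurableSet.iUnion fun n => MeasurableSet.inter ?_ (measurable_snd (hAm n))
    have : Measurable fun z : (Λ → ℕ → ℕ) × P => z.1 l k := by fun_prop
    exact this (measurableSet_singleton n)
  have hU : ∀ l, MeasurableSet (U l) := by
    intro l
    simp only [U, Filter.frequently_atTop]
    have : {z : (Λ → ℕ → ℕ) × P | ∀ a, ∃ b ≥ a, z.2 ∈ A (z.1 l b)} =
      ⋂ a, ⋃ b, ⋃ (_ : b ≥ a), {z | z.2 ∈ A (z.1 l b)} := by ext z; simp
    rw [this]
    exact MeasurableSet.iInter fun a => MeasurableSet.iUnion fun b => MeasurableSet.iUnion fun _ =>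
      hA1 l b
  obtain ⟨D, hDm, hD, -⟩ := aux_choice (fun l => U l ∩ ⋂ l', ⋂ (_ : l' ≠ l), (U l')ᶜ)
    (fun l => (hU l).inter (MeasurableSet.iInter fun l' => MeasurableSet.iInter fun _ =>
      (hU l').compl)) (Classical.arbitrary Λ) (by
      rintro l l' z ⟨hz, -⟩ ⟨-, hz'⟩
      by_contra hne
      simp only [Set.mem_iInter] at hz'
      exact hz' l hne hz)
  let E : (Λ → ℕ → ℕ) → Λ → Set P := fun c l => {p | D (c, p) = l}
  have hW : ∀ l n, Measurable fun c => m (E c l ∆ A n) := by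
    intro l n
    have h1 : MeasurableSet ({z | D z = l} ∆ (Prod.snd ⁻¹' A n)) :=
      (hDm (measurableSet_singleton l)).symmDiff (measurable_snd (hAm n))
    exact measurable_measure_prodMk_left h1
  let Q : Set P → ℕ → ℕ → Prop := fun F k n => m (F ∆ A n) < ENNReal.ofReal ((1/2)^k)
  let K : Set (Λ → ℕ → ℕ) := {c | ∀ l k n, c l k = n → (Q (E c l) k n ∧ ∀ n' < n, ¬ Q (E c l) k n')}
  refine ⟨D, K, hDm, ?_, ?_, ?_⟩
  · have hQm : ∀ l k n, MeasurableSet {c | Q (E c l) k n} := fun l k n =>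
      measurableSet_lt (hW l n) measurable_const
    have : K = ⋂ l, ⋂ k, ⋂ n, ({c | c l k = n}ᶜ ∪ ({c | Q (E c l) k n} ∩ ⋂ n', ⋂ (_ : n' < n),
        {c | Q (E c l) k n'}ᶜ)) := by
      ext c
      simp only [K, Set.mem_ofPred_eq, Set.mem_iInter, Set.mem_union, Set.mem_compl_iff,
        Set.mem_inter_iff, imp_iff_not_or]
    rw [this]
    refine MeasurableSet.iInter fun l => MeasurableSet.iInter fun k => MeasurableSet.iInter fun n =>
      MeasurableSet.union (MeasurableSet.compl ?_) ((hQm l k n).inter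
        (MeasurableSet.iInter fun n' => MeasurableSet.iInter fun _ => (hQm l k n').compl))
    have : Measurable fun c : Λ → ℕ → ℕ => c l k := by fun_prop
    exact this (measurableSet_singleton n)
  · intro φ hφ
    have hex : ∀ l k, ∃ n, Q {p | φ p = l} k n := fun l k =>
      hAd _ (hφ (measurableSet_singleton l)) _ (by positivity)
    let c : Λ → ℕ → ℕ := fun l k => Nat.find (hex l k)
    have hev : ∀ᵐ p ∂m, ∀ l, ∀ᶠ k in Filter.atTop, p ∉ {p | φ p = l} ∆ A (c l k) := by
      rw [ae_all_iff]
      intro l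
      refine ae_eventually_notMem ?_
      refine ne_top_of_le_ne_top ?_ (ENNReal.tsum_le_tsum fun k => (Nat.find_spec (hex l k)).le)
      rw [← ENNReal.ofReal_tsum_of_nonneg (fun _ => by positivity) summable_geometric_two]
      exact ENNReal.ofReal_ne_top
    have hDc : ∀ᵐ p ∂m, D (c, p) = φ p := by
      filter_upwards [hev] with p hp
      apply hD
      have key : ∀ l, (c, p) ∈ U l ↔ φ p = l := by
        intro l
        have h1 : ∀ᶠ k in Filter.atTop, (p ∈ A (c l k) ↔ φ p = l) := by
          filter_upwards [hp l] with k hk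
          simp only [Set.mem_symmDiff, Set.mem_ofPred_eq] at hk
          tauto
        simp only [U, Set.mem_ofPred_eq]
        rw [Filter.frequently_congr h1]
        simp
      refine ⟨(key _).2 rfl, ?_⟩
      simp only [Set.mem_iInter, Set.mem_compl_iff, key]
      intro l' h h'
      exact h h'.symm
    refine ⟨c, ?_, hDc⟩
    have hQ : ∀ l k n, Q (E c l) k n ↔ Q {p | φ p = l} k n := by
      intro l k n
      have : m (E c l ∆ A n) = m ({p | φ p = l} ∆ A n) := by
        apply measure_congr
        filter_upwards [hDc] with p hp
        have : (p ∈ E c l ∆ A n) = (p ∈ {p | φ p = l} ∆ A n) := by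
          simp only [Set.mem_symmDiff, E, Set.mem_ofPred_eq, hp]
        exact this
      simp only [Q, this]
    rintro l k n rfl
    refine ⟨(hQ _ _ _).2 (Nat.find_spec (hex l k)), fun n' hn' h => ?_⟩
    exact Nat.find_min (hex l k) hn' ((hQ _ _ _).1 h)
  · intro c hc c' hc' h
    have hQ : ∀ l k n, Q (E c l) k n ↔ Q (E c' l) k n := by
      intro l k n
      have : m (E c l ∆ A n) = m (E c' l ∆ A n) := by
        apply measure_congr
        filter_upwards [h] with p hp
        have : (p ∈ E c l ∆ A n) = (p ∈ E c' l ∆ A n) := by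
          simp only [Set.mem_symmDiff, E, Set.mem_ofPred_eq, hp]
        exact this
      simp only [Q, this]
    funext l k
    obtain ⟨h1, h2⟩ := hc l k _ rfl
    obtain ⟨h1', h2'⟩ := hc' l k _ rfl
    rcases lt_trichotomy (c l k) (c' l k) with h | h | h
    · exact absurd ((hQ _ _ _).1 h1) (h2' _ h)
    · exact h
    · exact absurd ((hQ _ _ _).2 h1') (h2 _ h)

theorem aux_select {P Y Λ : Type} [MeasurableSpace P] [StandardBorelSpace P] (M : Measure P)
    [SFinite M] (hM : M ≠ 0) [MeasurableSpace Λ] [DiscreteMeasurableSpace Λ] [Countable Λ] [Group Λ]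
    [MeasurableSpace Y] [StandardBorelSpace Y]
    (R : Y → (P → Λ) → Prop)
    (hmeas : ∀ (C : Type) [MeasurableSpace C] (D : C × P → Λ), Measurable D →
      MeasurableSet {z : Y × C | R z.1 (fun p => D (z.2, p))})
    (hcongr : ∀ y φ φ', (∀ᵐ p ∂M, φ p = φ' p) → R y φ → R y φ')
    (huniq : ∀ y φ φ', Measurable φ → Measurable φ' → R y φ → R y φ' →
      ∃ l : Λ, ∀ᵐ p ∂M, φ p = l * φ' p) :
    MeasurableSet {y | ∃ φ, Measurable φ ∧ R y φ} ∧ ∃ Φ : Y × P → Λ, Measurable Φ ∧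
      ∀ y, (∃ φ, Measurable φ ∧ R y φ) → R y (fun p => Φ (y, p)) := by
  classical
  set m := M.toFinite with hm
  have hae : ∀ {q : P → Prop}, (∀ᵐ p ∂m, q p) ↔ ∀ᵐ p ∂M, q p := by
    intro q; rw [hm, ae_toFinite]
  have hm0 : m ≠ 0 := by
    rw [← ae_neBot, hm, ae_toFinite, ae_neBot]; exact hM
  obtain ⟨D, K, hDm, hK, hDsurj, hDinj⟩ := aux_code (Λ := Λ) m
  obtain ⟨𝒜, h𝒜c, h𝒜⟩ := exists_countable_measureDense m
  obtain ⟨A, hA⟩ := h𝒜c.exists_eq_range h𝒜.nonempty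
  have hAm : ∀ n, MeasurableSet (A n) := fun n => h𝒜.measurable _ (hA ▸ Set.mem_range_self n)
  have hAd : ∀ E, MeasurableSet E → ∀ ε : ℝ, 0 < ε → ∃ n, m (E ∆ A n) < ENNReal.ofReal ε := by
    intro E hE ε hε
    obtain ⟨t, ht, h⟩ := h𝒜.approx E hE (measure_ne_top _ _) ε hε
    rw [hA] at ht
    obtain ⟨n, rfl⟩ := ht
    exact ⟨n, h⟩
  have hDc : ∀ c, Measurable fun p => D (c, p) := fun c => hDm.comp (by fun_prop)
  let E : (Λ → ℕ → ℕ) → Λ → Set P := fun c l => {p | D (c, p) = l}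
  have hEm : ∀ c l, MeasurableSet (E c l) := fun c l => hDc c (measurableSet_singleton l)
  have hW : ∀ l n, Measurable fun c => m (E c l ∆ A n) := by
    intro l n
    have h1 : MeasurableSet ({z | D z = l} ∆ (Prod.snd ⁻¹' A n)) :=
      (hDm (measurableSet_singleton l)).symmDiff (measurable_snd (hAm n))
    exact measurable_measure_prodMk_left h1
  have hW' : ∀ l, Measurable fun c => m (E c l) := by
    intro l
    have h1 : MeasurableSet {z | D z = l} := hDm (measurableSet_singleton l)
    exact measurable_measure_prodMk_left h1
  let S : Λ × ℕ → Set (Y × (Λ → ℕ → ℕ)) := fun i =>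
    {z | R z.1 (fun p => D (z.2, p))} ∩ Prod.snd ⁻¹' (K ∩ {c | m (E c i.1 ∆ A i.2) < m (E c i.1)})
  have hS : ∀ i, MeasurableSet (S i) := fun i => (hmeas _ D hDm).inter
    (measurable_snd (hK.inter (measurableSet_lt (hW _ _) (hW' _))))
  have hinj : ∀ i, Set.InjOn Prod.fst (S i) := by
    rintro ⟨l, n⟩ ⟨y, c⟩ ⟨h1, h2, h3⟩ ⟨y', c'⟩ ⟨h1', h2', h3'⟩ (rfl : y = y')
    simp only [Set.mem_ofPred_eq] at h1 h1' h3 h3'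
    obtain ⟨t, ht⟩ := huniq y _ _ (hDc c) (hDc c') h1 h1'
    have ht1 : t = 1 := by
      by_contra hne
      have hd : AEDisjoint m (E c l) (E c' l) := by
        have : ∀ᵐ p ∂m, p ∉ E c l ∩ E c' l := by
          rw [hae]
          filter_upwards [ht] with p hp
          rintro ⟨q1, q2⟩
          simp only [E, Set.mem_ofPred_eq] at q1 q2
          rw [q1, q2] at hp
          exact hne (right_eq_mul.mp hp)
        simpa [AEDisjoint, ae_iff] using this
      have e1 : m (E c l) + m (E c' l) ≤ m (E c l ∆ A n) + m (E c' l ∆ A n) := by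
        rw [← measure_union₀ (hEm _ _).nullMeasurableSet hd]
        have : m (E c l ∪ E c' l) = m (E c l ∆ E c' l) := by
          rw [Set.symmDiff_def, ← Set.sdiff_inter_self_eq_sdiff (s := E c' l)]
          have : (E c l ∪ E c' l) \ (E c l ∩ E c' l) =
            E c l \ E c' l ∪ E c' l \ (E c l ∩ E c' l) := by ext; simp; tauto
          rw [← this]
          exact (measure_sdiff_null hd).symm
        rw [this]
        refine (measure_symmDiff_le _ (A n) _).trans ?_
        rw [symmDiff_comm (A n)]
      exact absurd e1 (not_le.2 (ENNReal.add_lt_add h3 h3'))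
    have : c = c' := by
      apply hDinj c h2 c' h2'
      rw [hae]
      filter_upwards [ht] with p hp
      simpa [ht1] using hp
    rw [this]
  obtain ⟨hm1, σ, hσ, hσS⟩ := aux_section S hS hinj
  have himg : (Prod.fst '' ⋃ i, S i) = {y | ∃ φ, Measurable φ ∧ R y φ} := by
    ext y
    constructor
    · rintro ⟨⟨y, c⟩, hc, rfl⟩
      obtain ⟨i, hi⟩ := Set.mem_iUnion.1 hc
      exact ⟨_, hDc c, hi.1⟩
    · rintro ⟨φ, hφ, hR⟩
      obtain ⟨c, hcK, hc⟩ := hDsurj φ hφ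
      have hex : ∃ l, 0 < m (E c l) := by
        by_contra hno
        push Not at hno
        have : m Set.univ = 0 := by
          have : (Set.univ : Set P) = ⋃ l, E c l := by ext; simp [E]
          rw [this, measure_iUnion_null_iff]
          intro l
          exact le_antisymm (hno l) bot_le
        exact hm0 (Measure.measure_univ_eq_zero.1 this)
      obtain ⟨l, hl⟩ := hex
      obtain ⟨n, hn⟩ := hAd (E c l) (hEm _ _) (m (E c l)).toReal
        (ENNReal.toReal_pos hl.ne' (measure_ne_top _ _))
      rw [ENNReal.ofReal_toReal (measure_ne_top _ _)] at hn
      refine ⟨(y, c), Set.mem_iUnion.2 ⟨(l, n), ?_, hcK, hn⟩, rfl⟩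
      refine hcongr y φ _ ?_ hR
      rw [hae] at hc
      filter_upwards [hc] with p hp using hp.symm
  rw [himg] at hm1 hσS
  refine ⟨hm1, fun z => D (σ z.1, z.2), hDm.comp (by fun_prop), ?_⟩
  intro y hy
  obtain ⟨i, hi⟩ := Set.mem_iUnion.1 (hσS y hy)
  exact hi.1

end Aux
section Aux2

theorem qmp_skew {X X' Z Z' : Type*} [MeasurableSpace X] [MeasurableSpace X'] [MeasurableSpace Z]
    [MeasurableSpace Z'] {μ : Measure X} {μ' : Measure X'} {ν : Measure Z} {ν' : Measure Z'}
    [SFinite ν] [SFinite ν'] {u : X → X'} (hu : Measure.QuasiMeasurePreserving u μ μ')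
    {v : X → Z → Z'} (hv : Measurable fun p : X × Z => v p.1 p.2)
    (hvq : ∀ x, Measure.QuasiMeasurePreserving (v x) ν ν') :
    Measure.QuasiMeasurePreserving (fun p : X × Z => (u p.1, v p.1 p.2)) (μ.prod ν) (μ'.prod ν') := by
  have hm : Measurable (fun p : X × Z => (u p.1, v p.1 p.2)) :=
    (hu.measurable.comp measurable_fst).prodMk hv
  refine ⟨hm, Measure.AbsolutelyContinuous.mk fun N hN h => ?_⟩
  rw [Measure.map_apply hm hN, Measure.measure_prod_null (hm hN)]
  rw [Measure.measure_prod_null hN] at h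
  filter_upwards [hu.ae h] with x hx
  exact (hvq x).preimage_null hx

theorem mah_ac1 {X : Type*} [MeasurableSpace X] (μ : Measure X) [SFinite μ] :
    maharamMeasure μ ≪ μ.prod volume :=
  Measure.AbsolutelyContinuous.rfl.prod (withDensity_absolutelyContinuous _ _)

theorem mah_ac2 {X : Type*} [MeasurableSpace X] (μ : Measure X) [SFinite μ] :
    μ.prod volume ≪ maharamMeasure μ := by
  refine Measure.AbsolutelyContinuous.rfl.prod (withDensity_absolutelyContinuous' ?_ ?_)
  · exact Measurable.aemeasurable (by fun_prop)
  · exact Filter.Eventually.of_forall fun s => by simp [Real.exp_pos]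

theorem mah_qmp {X : Type*} [MeasurableSpace X] (μ : Measure X) [SFinite μ] (u : X → X)
    (hu : Measure.QuasiMeasurePreserving u μ μ) (w : X → ℝ) (hw : Measurable w) :
    Measure.QuasiMeasurePreserving (fun p : X × ℝ => (u p.1, w p.1 + p.2))
      (maharamMeasure μ) (maharamMeasure μ) :=
  (qmp_skew (v := fun x s => w x + s) hu (by fun_prop)
    (fun x => (measurePreserving_add_left volume (w x)).quasiMeasurePreserving)).mono
    (mah_ac1 μ) (mah_ac2 μ)

instance mah_sfinite {X : Type*} [MeasurableSpace X] (μ : Measure X) [SFinite μ] :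
    SFinite (maharamMeasure μ) := by
  unfold maharamMeasure; infer_instance

theorem mah_ne_zero {X : Type*} [MeasurableSpace X] (μ : Measure X) [IsProbabilityMeasure μ] :
    maharamMeasure μ ≠ 0 := by
  intro h
  have h1 := mah_ac2 μ
  rw [h, Measure.absolutelyContinuous_zero_iff] at h1
  have h2 : (μ.prod (volume : Measure ℝ)) (Set.univ ×ˢ Set.univ) = 0 := by rw [h1]; simp
  rw [Measure.prod_prod] at h2
  simp at h2

theorem ns_qmp {ι X : Type*} [MeasurableSpace X] {μ : Measure X} {a : ι → X → X}
    (h : Nonsingular μ a) (g : ι) : Measure.QuasiMeasurePreserving (a g) μ μ :=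
  ⟨(h g).1, (h g).2.1⟩

theorem mah_image {G X : Type*} [Group G] [MeasurableSpace X] (μ : Measure X) [SFinite μ]
    (a : G → X → X) (ha : IsAction a) (hns : Nonsingular μ a) (ω : G → X → ℝ)
    (hω : ∀ g, Measurable (ω g)) (g : G) (B B' : Set (X × ℝ))
    (h : ∀ᵐ p ∂(maharamMeasure μ), (p ∈ B ↔ maharamAct a ω g p ∈ B')) :
    maharamMeasure μ ((maharamAct a ω g '' B) ∆ B') = 0 := by
  have hq := mah_qmp μ (a g⁻¹) (ns_qmp hns _) (fun x => - ω g (a g⁻¹ x))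
    ((hω g).comp (hns g⁻¹).1).neg
  set I : X × ℝ → X × ℝ := (fun p : X × ℝ => (a g⁻¹ p.1, - ω g (a g⁻¹ p.1) + p.2)) with hI
  have hTI : ∀ p, maharamAct a ω g (I p) = p := by
    rintro ⟨x, s⟩
    simp [maharamAct, hI, ← ha.2, ha.1]
  have hIT : ∀ p, I (maharamAct a ω g p) = p := by
    rintro ⟨x, s⟩
    simp [maharamAct, hI, ← ha.2, ha.1]
  have h2 := hq.ae h
  refine measure_mono_null ?_ h2
  intro p hp
  simp only [Set.mem_compl_iff, Set.mem_ofPred_eq]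
  rw [hTI]
  intro hiff
  have : p ∈ maharamAct a ω g '' B ↔ I p ∈ B := by
    constructor
    · rintro ⟨q, hq, rfl⟩; rwa [hIT]
    · intro hq; exact ⟨_, hq, hTI p⟩
  rw [Set.mem_symmDiff, this, hiff] at hp
  tauto

theorem aux_const {G P Λ : Type*} [Group G] [Group Λ] [Countable Λ] [Countable G]
    [MeasurableSpace P] (M : Measure P) (hM : M ≠ 0)
    [MeasurableSpace Λ] [DiscreteMeasurableSpace Λ] (T : G → P → P)
    (himg : ∀ g B B', (∀ᵐ p ∂M, (p ∈ B ↔ T g p ∈ B')) → M ((T g '' B) ∆ B') = 0)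
    (herg : ErgodicAction M T) (hni : ¬ IsInduced M T) (δ : G →* Λ) (ψ : P → Λ)
    (hψm : Measurable ψ) (hψ : ∀ g, ∀ᵐ p ∂M, ψ (T g p) = δ g * ψ p * (δ g)⁻¹) :
    ∃ l ∈ Subgroup.centralizer (Set.range δ), ∀ᵐ p ∂M, ψ p = l := by
  classical
  have hex : ∃ l, 0 < M (ψ ⁻¹' {l}) := by
    by_contra hno
    push Not at hno
    have : M Set.univ = 0 := by
      have : (Set.univ : Set P) = ⋃ l, ψ ⁻¹' {l} := by ext; simp
      rw [this, measure_iUnion_null_iff]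
      intro l
      exact le_antisymm (hno l) bot_le
    exact hM (Measure.measure_univ_eq_zero.1 this)
  obtain ⟨l, hl⟩ := hex
  -- translates of the level set
  have htr : ∀ g, M ((T g '' (ψ ⁻¹' {l})) ∆ (ψ ⁻¹' {δ g * l * (δ g)⁻¹})) = 0 := by
    intro g
    apply himg
    filter_upwards [hψ g] with p hp
    simp [hp]
  let W : Set P := ⋃ g, ψ ⁻¹' {δ g * l * (δ g)⁻¹}
  have hWm : MeasurableSet W := MeasurableSet.iUnion fun g => hψm (measurableSet_singleton _)
  have hW0 : M Wᶜ = 0 := by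
    refine (herg W hWm fun g => ?_).resolve_left ?_
    · apply himg
      filter_upwards [hψ g] with p hp
      simp only [W, Set.mem_iUnion, Set.mem_preimage, Set.mem_singleton_iff, hp]
      constructor
      · rintro ⟨i, hi⟩
        exact ⟨g * i, by rw [hi]; simp [mul_assoc]⟩
      · rintro ⟨i, hi⟩
        refine ⟨g⁻¹ * i, ?_⟩
        have : ψ p = (δ g)⁻¹ * (δ g * ψ p * (δ g)⁻¹) * δ g := by group
        rw [this, hi]; simp [mul_assoc]
    · intro h0
      refine hl.ne' (measure_mono_null ?_ h0)
      intro p hp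
      exact Set.mem_iUnion.2 ⟨1, by simpa using hp⟩
  let G₀ : Subgroup G :=
    { carrier := {g | δ g * l * (δ g)⁻¹ = l}
      mul_mem' := by
        intro g h hg hh
        simp only [Set.mem_ofPred_eq] at hg hh ⊢
        calc δ (g * h) * l * (δ (g * h))⁻¹ = δ g * (δ h * l * (δ h)⁻¹) * (δ g)⁻¹ := by
              simp [mul_assoc]
          _ = l := by rw [hh, hg]
      one_mem' := by simp
      inv_mem' := by
        intro g hg
        simp only [Set.mem_ofPred_eq] at hg ⊢
        nth_rewrite 1 [← hg]
        simp [mul_assoc] }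
  have hG₀ : ∀ g, g ∈ G₀ ↔ δ g * l * (δ g)⁻¹ = l := fun g => Iff.rfl
  have hmul : ∀ g k, k ∈ G₀ → δ (g * k) * l * (δ (g * k))⁻¹ = δ g * l * (δ g)⁻¹ := by
    intro g k hk
    rw [hG₀] at hk
    calc δ (g * k) * l * (δ (g * k))⁻¹ = δ g * (δ k * l * (δ k)⁻¹) * (δ g)⁻¹ := by
              simp [mul_assoc]
          _ = _ := by rw [hk]
  have hsep : ∀ g h, δ g * l * (δ g)⁻¹ = δ h * l * (δ h)⁻¹ → g⁻¹ * h ∈ G₀ := by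
    intro g h e
    rw [hG₀]
    have : δ (g⁻¹ * h) * l * (δ (g⁻¹ * h))⁻¹ = (δ g)⁻¹ * (δ h * l * (δ h)⁻¹) * δ g := by
      simp [mul_assoc]
    rw [this, ← e]; group
  have htop : G₀ = ⊤ := by
    by_contra hne
    apply hni
    refine ⟨G₀, hne, ψ ⁻¹' {l}, hψm (measurableSet_singleton l), hl, ?_, ?_⟩
    · intro g hg
      have := htr g
      rwa [(hG₀ g).1 hg] at this
    · refine ⟨Set.range (Quotient.out : G ⧸ G₀ → G), ?_, ?_, ?_⟩
      · intro g
        refine ⟨((g : G ⧸ G₀)).out, ⟨Set.mem_range_self _, ?_⟩, ?_⟩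
        · rw [← QuotientGroup.eq]; simp
        · rintro _ ⟨⟨q, rfl⟩, hq⟩
          rw [← QuotientGroup.eq] at hq
          rw [hq]; simp
      · rintro _ ⟨q, rfl⟩ _ ⟨q', rfl⟩ hqq
        have hne' : δ q.out * l * (δ q.out)⁻¹ ≠ δ q'.out * l * (δ q'.out)⁻¹ := by
          intro e
          have := hsep _ _ e
          rw [← QuotientGroup.eq] at this
          simp only [QuotientGroup.out_eq'] at this
          exact hqq (by rw [this])
        refine measure_mono_null ?_ (measure_union_null (htr q.out) (htr q'.out))
        rintro p ⟨h1, h2⟩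
        simp only [Set.mem_union, Set.mem_symmDiff]
        by_cases h3 : p ∈ ψ ⁻¹' {δ q.out * l * (δ q.out)⁻¹}
        · right; left
          refine ⟨h2, fun h4 => hne' ?_⟩
          simp only [Set.mem_preimage, Set.mem_singleton_iff] at h3 h4
          rw [← h3, h4]
        · left; left; exact ⟨h1, h3⟩
      · refine measure_mono_null (t := Wᶜ ∪ ⋃ g, ((T g '' (ψ ⁻¹' {l})) ∆
          (ψ ⁻¹' {δ g * l * (δ g)⁻¹}))) ?_ (measure_union_null hW0 (measure_iUnion_null htr))
        intro p hp
        by_cases hpW : p ∈ W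
        · right
          obtain ⟨g, hg⟩ := Set.mem_iUnion.1 hpW
          have hk : ((g : G ⧸ G₀)).out⁻¹ * g ∈ G₀ := by rw [← QuotientGroup.eq]; simp
          have e := hmul ((g : G ⧸ G₀)).out _ hk
          rw [mul_inv_cancel_left] at e
          rw [e] at hg
          refine Set.mem_iUnion.2 ⟨((g : G ⧸ G₀)).out, ?_⟩
          rw [Set.mem_symmDiff]
          right
          refine ⟨hg, fun hh => hp ?_⟩
          exact Set.mem_biUnion (Set.mem_range_self _) hh
        · left; exact hpW
  have hall : ∀ g, δ g * l * (δ g)⁻¹ = l := fun g => (hG₀ g).1 (htop ▸ Subgroup.mem_top g)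
  refine ⟨l, ?_, ?_⟩
  · rw [Subgroup.mem_centralizer_iff]
    rintro _ ⟨g, rfl⟩
    have := hall g
    rw [mul_inv_eq_iff_eq_mul] at this
    exact this
  · have hWl : W = ψ ⁻¹' {l} := by
      ext p
      simp [W, hall]
    rw [hWl] at hW0
    exact hW0

theorem aux_homs {G Λ : Type*} [Group G] (hFG : Group.FG G) [Group Λ] [Countable Λ] :
    Countable (G →* Λ) := by
  obtain ⟨S, hS⟩ := hFG.out
  have : Function.Injective (fun (δ : G →* Λ) (s : S) => δ s) := by
    intro δ δ' h
    refine MonoidHom.eq_of_eqOn_dense hS ?_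
    intro s hs
    exact congrFun h ⟨s, hs⟩
  exact this.countable

end Aux2
section Aux3

theorem aux_aeset {Z P : Type*} [MeasurableSpace Z] [MeasurableSpace P] (M : Measure P) [SFinite M]
    {q : Z → P → Prop} (h : MeasurableSet {w : Z × P | q w.1 w.2}) :
    MeasurableSet {z | ∀ᵐ p ∂M, q z p} := by
  have h1 := measurable_measure_prodMk_left (ν := M) h.compl
  exact h1 (measurableSet_singleton 0)

theorem aux_swap {Z P : Type*} [MeasurableSpace Z] [MeasurableSpace P] {N : Measure Z}
    {M : Measure P} [SFinite M] [SFinite N]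
    {q : Z → P → Prop} (h : MeasurableSet {w : Z × P | q w.1 w.2})
    (h1 : ∀ᵐ z ∂N, ∀ᵐ p ∂M, q z p) : ∀ᵐ p ∂M, ∀ᵐ z ∂N, q z p :=
  (Measure.ae_ae_comm h).1 h1

theorem aux_shear {X : Type*} [MeasurableSpace X] (μ : Measure X) [SFinite μ]
    (B : ℝ → X → ℝ → Prop) (hB : MeasurableSet {w : ℝ × X × ℝ | B w.1 w.2.1 w.2.2})
    (h : ∀ᵐ t, ∀ᵐ p ∂(maharamMeasure μ), B t p.1 p.2) :
    ∀ᵐ s, ∀ᵐ p ∂(maharamMeasure μ), B (p.2 - s) p.1 s := by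
  have h1 : ∀ᵐ t, ∀ᵐ x ∂μ, ∀ᵐ s, B t x s := by
    filter_upwards [h] with t ht
    exact Measure.ae_ae_of_ae_prod ((mah_ac2 μ).ae_le ht)
  have m1 : MeasurableSet {w : ℝ × X | ∀ᵐ s, B w.1 w.2 s} := by
    apply aux_aeset
    have : Measurable fun w : (ℝ × X) × ℝ => ((w.1.1, w.1.2, w.2) : ℝ × X × ℝ) := by fun_prop
    exact this hB
  have h2 : ∀ᵐ x ∂μ, ∀ᵐ t, ∀ᵐ s, B t x s := aux_swap m1 h1
  have h3 : ∀ᵐ x ∂μ, ∀ᵐ s, ∀ᵐ r, B (r - s) x s := by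
    filter_upwards [h2] with x hx
    have m2 : MeasurableSet {w : ℝ × ℝ | B w.1 x w.2} := by
      have : Measurable fun w : ℝ × ℝ => ((w.1, x, w.2) : ℝ × X × ℝ) := by fun_prop
      exact this hB
    filter_upwards [aux_swap m2 hx] with s hs
    exact (measurePreserving_sub_right volume s).quasiMeasurePreserving.ae hs
  have m3 : MeasurableSet {w : X × ℝ | ∀ᵐ r, B (r - w.2) w.1 w.2} := by
    apply aux_aeset
    have : Measurable fun w : (X × ℝ) × ℝ => ((w.2 - w.1.2, w.1.1, w.1.2) : ℝ × X × ℝ) := by fun_prop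
    exact this hB
  have h4 := aux_swap m3 h3
  filter_upwards [h4] with s hs
  refine (mah_ac1 μ).ae_le ?_
  have m4 : MeasurableSet {w : X × ℝ | B (w.2 - s) w.1 s} := by
    have : Measurable fun w : X × ℝ => ((w.2 - s, w.1, s) : ℝ × X × ℝ) := by fun_prop
    exact this hB
  exact (Measure.ae_prod_iff_ae_ae m4).2 hs

end Aux3

theorem cocycle_superrigidity_skew_product
    {G X Y : Type} [Group G] [Countable G] (hFG : Group.FG G)
    [MeasurableSpace X] [StandardBorelSpace X] (μ : Measure X) [IsProbabilityMeasure μ]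
    (a : G → X → X) (ha : IsAction a)
    (hns : Nonsingular μ a) (hfree : EssentiallyFree μ a) (herg : ErgodicAction μ a)
    (ω : G → X → ℝ) (hω : IsLogRNCocycle μ a ω)
    (hIII1 : ErgodicAction (maharamMeasure μ) (maharamAct a ω))
    (hnotind : ¬ IsInduced (maharamMeasure μ) (maharamAct a ω))
    (hsuper : CocycleSuperrigid (maharamMeasure μ) (maharamAct a ω))
    [MeasurableSpace Y] [StandardBorelSpace Y] (η : Measure Y) [IsProbabilityMeasure η]
    (f : ℝ → Y → Y) (hf : IsFlow f) (hfm : Measurable fun p : ℝ × Y => f p.1 p.2)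
    (hfns : Nonsingular η f) (hferg : ErgodicAction η f) :
    ∀ (Λ : Type) [Group Λ] [Countable Λ], ∀ Ω : G → X × Y → Λ,
      IsCocycle (μ.prod η) (fun (g : G) (p : X × Y) => (a g p.1, f (ω g p.1) p.2)) Ω →
      ∃ δ : G →* Λ, ∃ γ : ℝ × Y → Λ, MeasurableDiscrete γ ∧
        (∀ (t : ℝ) (y : Y), γ (t, y) ∈ Subgroup.centralizer (Set.range δ)) ∧
        (∀ s t : ℝ, ∀ᵐ y ∂η, γ (s + t, y) = γ (s, f t y) * γ (t, y)) ∧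
        ∃ φ : X × Y → Λ, MeasurableDiscrete φ ∧
          ∀ g : G, ∀ᵐ p ∂(μ.prod η),
            Ω g p = (φ (a g p.1, f (ω g p.1) p.2))⁻¹ * δ g * γ (ω g p.1, p.2) * φ p := by
  classical
  intro Λ _ _ Ω hΩ
  let _ : MeasurableSpace Λ := ⊤
  have : DiscreteMeasurableSpace Λ := ⟨fun _ => trivial⟩
  have hMD : ∀ {Z : Type} [MeasurableSpace Z] (F : Z → Λ), MeasurableDiscrete F ↔ Measurable F := by
    intro Z _ F
    exact ⟨fun h => measurable_to_countable' fun l => h l, fun h l => h (measurableSet_singleton l)⟩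
  set M := maharamMeasure μ with hMdef
  set T := maharamAct a ω with hT
  have hM0 : M ≠ 0 := mah_ne_zero μ
  have : (ae M).NeBot := ae_neBot.2 hM0
  have hΩm : ∀ g, Measurable (Ω g) := fun g => (hMD _).1 (hΩ.1 g)
  have hTq : ∀ g, Measure.QuasiMeasurePreserving (T g) M M := fun g =>
    mah_qmp μ (a g) (ns_qmp hns g) (ω g) (hω.1 g)
  have hTm : ∀ g, Measurable (T g) := fun g => (hTq g).measurable
  have hfq : ∀ t, Measure.QuasiMeasurePreserving (f t) η η := ns_qmp hfns
  have hf2 : ∀ {Z : Type} [MeasurableSpace Z] {u : Z → ℝ} {v : Z → Y}, Measurable u →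
      Measurable v → Measurable fun z => f (u z) (v z) := fun hu hv => hfm.comp (hu.prodMk hv)
  let sh : ℝ → X × ℝ → X × ℝ := fun t p => (p.1, t + p.2)
  have hshq : ∀ t, Measure.QuasiMeasurePreserving (sh t) M M := fun t =>
    mah_qmp μ id (Measure.QuasiMeasurePreserving.id μ) (fun _ => t) measurable_const
  have hshT : ∀ t g p, T g (sh t p) = sh t (T g p) := by
    intro t g p
    simp only [hT, maharamAct, sh]
    congr 1
    ring
  have hJ : Measure.QuasiMeasurePreserving (fun q : Y × (X × ℝ) => (q.2.1, f q.2.2 q.1))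
      (η.prod M) (μ.prod η) := by
    have h1 : Measure.QuasiMeasurePreserving (Prod.fst : X × ℝ → X) M μ :=
      Measure.quasiMeasurePreserving_fst
    have h2 := qmp_skew (ν := η) (ν' := η) (v := fun (p : X × ℝ) y => f p.2 y) h1
      (hf2 (by fun_prop) (by fun_prop)) (fun p => hfq p.2)
    exact h2.comp (Measure.measurePreserving_swap).quasiMeasurePreserving
  let R : (G →* Λ) → Y → (X × ℝ → Λ) → Prop := fun δ y φ =>
    ∀ g, ∀ᵐ p ∂M, Ω g (p.1, f p.2 y) = (φ (T g p))⁻¹ * δ g * φ p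
  have himg := mah_image μ a ha hns ω hω.1
  have hconst : ∀ δ y φ φ', Measurable φ → Measurable φ' → R δ y φ → R δ y φ' →
      ∃ l ∈ Subgroup.centralizer (Set.range δ), ∀ᵐ p ∂M, φ p = l * φ' p := by
    intro δ y φ φ' hφ hφ' h h'
    obtain ⟨l, hl, hl'⟩ := aux_const M hM0 T himg hIII1 hnotind δ (fun p => φ p * (φ' p)⁻¹)
      (hφ.mul hφ'.inv) (by
        intro g
        filter_upwards [h g, h' g] with p hp hp'
        have e1 : φ (T g p) = δ g * φ p * (Ω g (p.1, f p.2 y))⁻¹ := by rw [hp]; group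
        have e2 : φ' (T g p) = δ g * φ' p * (Ω g (p.1, f p.2 y))⁻¹ := by rw [hp']; group
        rw [e1, e2]; group)
    refine ⟨l, hl, ?_⟩
    filter_upwards [hl'] with p hp
    rw [← hp]; group
  have hRsh : ∀ δ y t φ, R δ y φ → R δ (f t y) (fun p => φ (sh t p)) := by
    intro δ y t φ h g
    filter_upwards [(hshq t).ae (h g)] with p hp
    rw [hshT] at hp
    rw [← hp]
    simp only [sh]
    rw [add_comm t, hf.2]
  -- step 1
  have step1 : ∀ᵐ y ∂η, ∃ δ, ∃ φ, Measurable φ ∧ R δ y φ := by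
    have h1 : ∀ᵐ y ∂η, ∀ g h, ∀ᵐ p ∂M, Ω (g * h) (p.1, f p.2 y) =
        Ω g (a h p.1, f (ω h p.1) (f p.2 y)) * Ω h (p.1, f p.2 y) := by
      rw [ae_all_iff]; intro g
      rw [ae_all_iff]; intro h
      exact Measure.ae_ae_of_ae_prod (hJ.ae (hΩ.2 g h))
    filter_upwards [h1] with y hy
    obtain ⟨δ, φ, hφ, h⟩ := hsuper Λ (fun g p => Ω g (p.1, f p.2 y)) (by
      refine ⟨fun g => (hMD _).2 ((hΩm g).comp (measurable_fst.prodMk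
        (hf2 measurable_snd measurable_const))), ?_⟩
      intro g h
      filter_upwards [hy g h] with p hp
      rw [hp]
      simp only [hT, maharamAct, hf.2])
    exact ⟨δ, φ, (hMD _).1 hφ, h⟩
  -- step 2
  have step2 : ∀ δ, MeasurableSet {y | ∃ φ, Measurable φ ∧ R δ y φ} ∧
      ∃ Φ : Y × (X × ℝ) → Λ, Measurable Φ ∧
      ∀ y, (∃ φ, Measurable φ ∧ R δ y φ) → R δ y (fun p => Φ (y, p)) := by
    intro δ
    refine aux_select M hM0 (R δ) ?_ ?_ ?_
    · intro C _ D hD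
      simp only [R]
      rw [Set.ofPred_forall]
      refine MeasurableSet.iInter fun g => ?_
      apply aux_aeset
      refine measurableSet_eq_fun ?_ ?_
      · exact (hΩm g).comp ((by fun_prop : Measurable fun w : (Y × C) × (X × ℝ) => w.2.1).prodMk
          (hf2 (by fun_prop) (by fun_prop)))
      · refine Measurable.mul (Measurable.mul (Measurable.inv ?_) measurable_const) ?_
        · exact hD.comp ((by fun_prop : Measurable fun w : (Y × C) × (X × ℝ) => w.1.2).prodMk
            ((hTm g).comp measurable_snd))
        · exact hD.comp (by fun_prop)
    · intro y φ φ' h hR g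
      filter_upwards [h, (hTq g).ae h, hR g] with p h1 h2 h3
      rw [h3, h1, h2]
    · intro y φ φ' h1 h2 h3 h4
      obtain ⟨l, -, hl⟩ := hconst δ y φ φ' h1 h2 h3 h4
      exact ⟨l, hl⟩
  -- step 3
  have hcount : Countable (G →* Λ) := aux_homs hFG
  have step3 : ∃ δ, ∀ᵐ y ∂η, ∃ φ, Measurable φ ∧ R δ y φ := by
    have hex : ∃ δ, η {y | ∃ φ, Measurable φ ∧ R δ y φ} ≠ 0 := by
      by_contra hno
      push Not at hno
      have h0 := measure_iUnion_null hno
      have h2 : ∀ᵐ y ∂η, y ∉ ⋃ δ, {y | ∃ φ, Measurable φ ∧ R δ y φ} := by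
        exact measure_eq_zero_iff_ae_notMem.1 h0
      obtain ⟨y, hy1, hy2⟩ := (step1.and h2).exists
      obtain ⟨δ, hδ⟩ := hy1
      exact hy2 (Set.mem_iUnion.2 ⟨δ, hδ⟩)
    obtain ⟨δ, hδ⟩ := hex
    refine ⟨δ, ?_⟩
    refine (hferg _ (step2 δ).1 ?_).resolve_left hδ
    intro t
    have hinv : ∀ t y, (∃ φ, Measurable φ ∧ R δ y φ) → ∃ φ, Measurable φ ∧ R δ (f t y) φ := by
      rintro t y ⟨φ, hφ, h⟩
      exact ⟨_, hφ.comp (hshq t).measurable, hRsh δ y t φ h⟩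
    have : f t '' {y | ∃ φ, Measurable φ ∧ R δ y φ} = {y | ∃ φ, Measurable φ ∧ R δ y φ} := by
      apply Set.Subset.antisymm
      · rintro _ ⟨y, hy, rfl⟩
        exact hinv t y hy
      · intro y hy
        refine ⟨f (-t) y, hinv (-t) y hy, ?_⟩
        rw [← hf.2, add_neg_cancel, hf.1]
    rw [this]; simp
  obtain ⟨δ, hY0⟩ := step3
  obtain ⟨-, Φ, hΦm, hΦ⟩ := step2 δ
  have hY : ∀ᵐ y ∂η, R δ y (fun p => Φ (y, p)) := by
    filter_upwards [hY0] with y hy using hΦ y hy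
  have hΦy : ∀ y, Measurable fun p => Φ (y, p) := fun y => hΦm.comp (by fun_prop)
  -- step 4
  obtain ⟨γ, hγm, hγ1, hγ2⟩ := aux_choice (fun l : Λ => {z : ℝ × Y |
      l ∈ Subgroup.centralizer (Set.range δ) ∧
      ∀ᵐ p ∂M, Φ (f z.1 z.2, p) = l * Φ (z.2, sh z.1 p)}) (by
      intro l
      refine MeasurableSet.inter (MeasurableSet.const _) ?_
      apply aux_aeset (Z := ℝ × Y)
      refine measurableSet_eq_fun ?_ ?_
      · exact hΦm.comp ((hfm.comp measurable_fst).prodMk measurable_snd)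
      · exact measurable_const.mul (hΦm.comp (by fun_prop))) 1 (by
      rintro l l' z ⟨-, h⟩ ⟨-, h'⟩
      obtain ⟨p, hp, hp'⟩ := (h.and h').exists
      rw [hp] at hp'
      exact mul_right_cancel hp')
  have hγC : ∀ t y, γ (t, y) ∈ Subgroup.centralizer (Set.range δ) := by
    intro t y
    by_cases h : ∃ l : Λ, l ∈ Subgroup.centralizer (Set.range δ) ∧
      ∀ᵐ p ∂M, Φ (f t y, p) = l * Φ (y, sh t p)
    · obtain ⟨l, hl⟩ := h
      rw [hγ1 l (t, y) hl]
      exact hl.1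
    · rw [hγ2 (t, y) (fun l hl => h ⟨l, hl⟩)]
      exact one_mem _
  have hγ : ∀ t y, R δ y (fun p => Φ (y, p)) → R δ (f t y) (fun p => Φ (f t y, p)) →
      ∀ᵐ p ∂M, Φ (f t y, p) = γ (t, y) * Φ (y, sh t p) := by
    intro t y h1 h2
    obtain ⟨l, hl, hl'⟩ := hconst δ (f t y) _ (fun p => Φ (y, sh t p)) (hΦy (f t y))
      ((hΦy y).comp (hshq t).measurable) h2 (hRsh δ y t (fun p => Φ (y, p)) h1)
    rw [hγ1 l (t, y) ⟨hl, hl'⟩]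
    exact hl'
  have hH1 : ∀ t, ∀ᵐ y ∂η, ∀ᵐ p ∂M, Φ (f t y, p) = γ (t, y) * Φ (y, sh t p) := by
    intro t
    filter_upwards [hY, (hfq t).ae hY] with y h1 h2 using hγ t y h1 h2
  have hcoc : ∀ s t : ℝ, ∀ᵐ y ∂η, γ (s + t, y) = γ (s, f t y) * γ (t, y) := by
    intro s t
    filter_upwards [hH1 (s + t), (hfq t).ae (hH1 s), hH1 t] with y h1 h2 h3
    obtain ⟨p, h1, h2, h3⟩ := (h1.and (h2.and ((hshq s).ae h3))).exists
    rw [hf.2, h2, h3] at h1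
    have : sh (s + t) p = sh t (sh s p) := by simp only [sh]; congr 1; ring
    rw [this, ← mul_assoc] at h1
    exact (mul_right_cancel h1).symm
  -- step 5
  have hH2 : ∃ r : ℝ, ∀ᵐ y ∂η, ∀ᵐ p ∂M,
      Φ (f (p.2 - r) y, (p.1, r)) = γ (p.2 - r, y) * Φ (y, p) := by
    have hBm : MeasurableSet {w : (ℝ × Y) × (X × ℝ) | Φ (f w.1.1 w.1.2, w.2) =
        γ (w.1.1, w.1.2) * Φ (w.1.2, sh w.1.1 w.2)} := by
      refine measurableSet_eq_fun ?_ ?_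
      · exact hΦm.comp ((hfm.comp measurable_fst).prodMk measurable_snd)
      · exact (hγm.comp (by fun_prop)).mul (hΦm.comp (by fun_prop))
    have h1 : ∀ᵐ y ∂η, ∀ᵐ t, ∀ᵐ p ∂M, Φ (f t y, p) = γ (t, y) * Φ (y, sh t p) := by
      refine aux_swap ?_ (Filter.Eventually.of_forall hH1)
      exact aux_aeset (Z := ℝ × Y) M hBm
    have h2 : ∀ᵐ y ∂η, ∀ᵐ r, ∀ᵐ p ∂M,
        Φ (f (p.2 - r) y, (p.1, r)) = γ (p.2 - r, y) * Φ (y, p) := by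
      filter_upwards [h1] with y hy
      have h3 := aux_shear μ (fun t x s => Φ (f t y, (x, s)) = γ (t, y) * Φ (y, sh t (x, s))) (by
        have : Measurable fun w : ℝ × X × ℝ => (((w.1, y), (w.2.1, w.2.2)) : (ℝ × Y) × (X × ℝ)) := by
          fun_prop
        exact this hBm) hy
      filter_upwards [h3] with r hr
      filter_upwards [hr] with p hp
      simpa [sh] using hp
    have h3 := aux_swap (by
      refine aux_aeset (Z := Y × ℝ) M (q := fun w p => Φ (f (p.2 - w.2) w.1, (p.1, w.2)) =
        γ (p.2 - w.2, w.1) * Φ (w.1, p)) ?_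
      refine measurableSet_eq_fun ?_ ?_
      · exact hΦm.comp ((hf2 (by fun_prop) (by fun_prop)).prodMk (by fun_prop))
      · exact (hγm.comp (by fun_prop)).mul (hΦm.comp (by fun_prop))) h2
    exact h3.exists
  obtain ⟨r, hr⟩ := hH2
  have hfr : Measurable (f (-r)) := (hfq (-r)).measurable
  refine ⟨δ, fun z => γ (z.1, f (-r) z.2), (hMD _).2 (hγm.comp (by fun_prop)), fun t y => hγC _ _,
    ?_, fun z => Φ (f (-r) z.2, (z.1, r)), (hMD _).2 (hΦm.comp (by fun_prop)), ?_⟩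
  · intro s t
    filter_upwards [(hfq (-r)).ae (hcoc s t)] with y hy
    rw [hy, ← hf.2, ← hf.2, add_comm t]
  intro g
  have hag : Measurable (a g) := (hns g).1
  have hωg : Measurable (ω g) := hω.1 g
  have hPm : MeasurableSet {p : X × Y | Ω g p =
      (Φ (f (-r) (f (ω g p.1) p.2), (a g p.1, r)))⁻¹ * δ g * γ (ω g p.1, f (-r) p.2) *
        Φ (f (-r) p.2, (p.1, r))} := by
    refine measurableSet_eq_fun (hΩm g) ?_
    refine Measurable.mul (Measurable.mul (Measurable.mul (Measurable.inv ?_) measurable_const) ?_) ?_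
    · exact hΦm.comp ((hfr.comp (hf2 (by fun_prop) (by fun_prop))).prodMk (by fun_prop))
    · exact hγm.comp (by fun_prop)
    · exact hΦm.comp (by fun_prop)
  have hiv : ∀ᵐ y ∂η, ∀ᵐ p ∂M, γ (ω g p.1 + (p.2 - r), y) =
      γ (ω g p.1, f (p.2 - r) y) * γ (p.2 - r, y) := by
    refine aux_swap ?_ (Filter.Eventually.of_forall fun p : X × ℝ => hcoc (ω g p.1) (p.2 - r))
    refine measurableSet_eq_fun (hγm.comp (by fun_prop)) ?_
    exact (hγm.comp ((by fun_prop : Measurable fun w : (X × ℝ) × Y => ω g w.1.1).prodMk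
      (hf2 (by fun_prop) (by fun_prop)))).mul (hγm.comp (by fun_prop))
  have hfin : ∀ᵐ y ∂η, ∀ᵐ p ∂M, (p.1, f p.2 y) ∈ {p : X × Y | Ω g p =
      (Φ (f (-r) (f (ω g p.1) p.2), (a g p.1, r)))⁻¹ * δ g * γ (ω g p.1, f (-r) p.2) *
        Φ (f (-r) p.2, (p.1, r))} := by
    filter_upwards [hY, hr, hiv] with y h1 h2 h3
    filter_upwards [h1 g, h2, (hTq g).ae h2, h3] with p e1 e2 e3 e4
    change Ω g (p.1, f p.2 y) = (Φ (f (-r) (f (ω g p.1) (f p.2 y)), (a g p.1, r)))⁻¹ * δ g *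
      γ (ω g p.1, f (-r) (f p.2 y)) * Φ (f (-r) (f p.2 y), (p.1, r))
    rw [e1]
    have c1 : f (-r) (f p.2 y) = f (p.2 - r) y := by rw [← hf.2]; congr 1; ring
    have c2 : f (-r) (f (ω g p.1) (f p.2 y)) = f (ω g p.1 + (p.2 - r)) y := by
      rw [← hf.2, ← hf.2]; congr 1; ring
    have c3 : (T g p).2 - r = ω g p.1 + (p.2 - r) := by
      simp only [hT, maharamAct]; ring
    have c4 : (T g p).1 = a g p.1 := rfl
    rw [c3, c4] at e3
    rw [c1, c2, e2, e3, e4]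
    have comm : ∀ c ∈ Subgroup.centralizer (Set.range δ), δ g * c = c * δ g := by
      intro c hc
      exact (Subgroup.mem_centralizer_iff.1 hc) _ ⟨g, rfl⟩
    have k1 := comm _ (hγC (ω g p.1) (f (p.2 - r) y))
    have k2 := comm _ (hγC (p.2 - r) y)
    set A := γ (ω g p.1, f (p.2 - r) y)
    set B := γ (p.2 - r, y)
    calc (Φ (y, T g p))⁻¹ * δ g * Φ (y, p)
        = (Φ (y, T g p))⁻¹ * B⁻¹ * A⁻¹ * (A * (B * δ g)) * Φ (y, p) := by group
      _ = (Φ (y, T g p))⁻¹ * B⁻¹ * A⁻¹ * ((A * δ g) * B) * Φ (y, p) := by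
          rw [← k2]; group
      _ = _ := by rw [← k1]; group
  have hfin2 : ∀ᵐ x ∂μ, ∀ᵐ s, ∀ᵐ y ∂η, (x, f s y) ∈ {p : X × Y | Ω g p =
      (Φ (f (-r) (f (ω g p.1) p.2), (a g p.1, r)))⁻¹ * δ g * γ (ω g p.1, f (-r) p.2) *
        Φ (f (-r) p.2, (p.1, r))} := by
    have h1 := aux_swap (by
      exact (measurable_snd.fst.prodMk (hf2 measurable_snd.snd measurable_fst)) hPm) hfin
    exact Measure.ae_ae_of_ae_prod ((mah_ac2 μ).ae_le h1)
  refine (Measure.ae_prod_iff_ae_ae hPm).2 ?_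
  filter_upwards [hfin2] with x hx
  obtain ⟨s, hs⟩ := hx.exists
  filter_upwards [(hfq (-s)).ae hs] with y hy
  rwa [← hf.2, add_neg_cancel, hf.1] at hy

end OESuperrigidity
end

section
/- Let G be a countable group with a nonsingular ergodic action on a standard probability space (X,μ) of type III₁, i.e. with logarithmic Radon–Nikodym cocycle ω : G × X → ℝ whose Maharam extension G ↷ X × ℝ is ergodic. Let ℝ act on a standard probability space (Y,η) as a nonsingular ergodic flow. Then the skew product action of G on (X × Y, μ × η) given by g·(x,y) = (g·x, ω(g,x)·y) is ergodic: every measurable S ⊆ X × Y with (μ×η)((g·S) Δ S) = 0 for all g ∈ G satisfies (μ×η)(S) = 0 or (μ×η)((X×Y)∖S) = 0. -/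
open MeasureTheory
open scoped symmDiff

namespace OESuperrigidity

open MeasureTheory


section helpers

variable {X Y : Type} [MeasurableSpace X] [MeasurableSpace Y]
  (μ : Measure X) [IsProbabilityMeasure μ] (η : Measure Y) [IsProbabilityMeasure η]
  (f : ℝ → Y → Y)

lemma maharam_ac : maharamMeasure μ ≪ μ.prod volume :=
  Measure.AbsolutelyContinuous.prod Measure.AbsolutelyContinuous.rfl
    (withDensity_absolutelyContinuous _ _)

lemma ac_maharam : μ.prod volume ≪ maharamMeasure μ := by
  refine Measure.AbsolutelyContinuous.prod Measure.AbsolutelyContinuous.rfl ?_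
  refine withDensity_absolutelyContinuous' (by fun_prop) ?_
  exact Filter.Eventually.of_forall fun s => by simp [Real.exp_pos]

/-- null in the Maharam sense iff null for the product. -/
lemma maharam_ae_iff (p : X × ℝ → Prop) :
    (∀ᵐ z ∂(maharamMeasure μ), p z) ↔ ∀ᵐ z ∂(μ.prod (volume : Measure ℝ)), p z :=
  ⟨fun h => (ac_maharam μ).ae_le h, fun h => (maharam_ac μ).ae_le h⟩

lemma ae_lift (hfm : Measurable fun p : ℝ × Y => f p.1 p.2) (hfns : Nonsingular η f)
    (S : Set (X × Y)) (hS : ∀ᵐ p ∂(μ.prod η), p ∈ S) :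
    ∀ᵐ y ∂η, ∀ᵐ z ∂(μ.prod (volume : Measure ℝ)), (z.1, f z.2 y) ∈ S := by
  obtain ⟨N, hN, hNm, hN0⟩ := exists_measurable_superset_of_null (ae_iff.1 hS)
  have hN' : ∀ᵐ p ∂(μ.prod η), p ∈ Nᶜ := by
    rw [ae_iff]; simpa using hN0
  have key : ∀ᵐ y ∂η, ∀ᵐ z ∂(μ.prod (volume : Measure ℝ)), (z.1, f z.2 y) ∈ Nᶜ := by
    rw [Measure.ae_ae_comm]
    · have h1 := Measure.ae_ae_of_ae_prod hN'
      have h2 := (Measure.quasiMeasurePreserving_fst (μ := μ)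
        (ν := (volume : Measure ℝ))).ae h1
      filter_upwards [h2] with z hz
      have hq : Measure.QuasiMeasurePreserving (f z.2) η η := ⟨(hfns z.2).1, (hfns z.2).2.1⟩
      exact hq.ae hz
    · have : Measurable fun q : Y × (X × ℝ) => (q.2.1, f q.2.2 q.1) :=
        (by fun_prop : Measurable fun q : Y × (X × ℝ) => q.2.1).prodMk
          (hfm.comp (by fun_prop : Measurable fun q : Y × (X × ℝ) => (q.2.2, q.1)))
      exact this hNm.compl
  filter_upwards [key] with y hy
  filter_upwards [hy] with z hz
  by_contra h
  exact hz (hN h)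

lemma ae_descend (hfm : Measurable fun p : ℝ × Y => f p.1 p.2) (hfns : Nonsingular η f)
    (S : Set (X × Y)) (hSm : MeasurableSet S)
    (h : ∀ᵐ y ∂η, ∀ᵐ z ∂(μ.prod (volume : Measure ℝ)), (z.1, f z.2 y) ∈ S) :
    ∀ᵐ p ∂(μ.prod η), p ∈ S := by
  rw [Measure.ae_ae_comm] at h
  · have h1 := Measure.ae_ae_of_ae_prod h
    have : ∀ᵐ x ∂μ, ∀ᵐ y ∂η, (x, y) ∈ S := by
      filter_upwards [h1] with x hx
      obtain ⟨s, hs⟩ := hx.exists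
      apply (hfns s).2.2.ae_le
      exact (ae_map_iff (hfns s).1.aemeasurable
        (measurable_prodMk_left hSm : MeasurableSet {y | (x, y) ∈ S})).2 hs
    exact (Measure.ae_prod_mem_iff_ae_ae_mem hSm).2 this
  · have : Measurable fun q : Y × (X × ℝ) => (q.2.1, f q.2.2 q.1) :=
      (by fun_prop : Measurable fun q : Y × (X × ℝ) => q.2.1).prodMk
        (hfm.comp (by fun_prop : Measurable fun q : Y × (X × ℝ) => (q.2.2, q.1)))
    exact this hSm

lemma ae_shift (t : ℝ) (p : X × ℝ → Prop) (h : ∀ᵐ z ∂(μ.prod (volume : Measure ℝ)), p z) :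
    ∀ᵐ z ∂(μ.prod (volume : Measure ℝ)), p (z.1, z.2 + t) := by
  have : MeasurePreserving (Prod.map id (fun s : ℝ => s + t))
      (μ.prod (volume : Measure ℝ)) (μ.prod (volume : Measure ℝ)) :=
    (MeasurePreserving.id μ).prod (measurePreserving_add_right volume t)
  exact this.quasiMeasurePreserving.ae h

end helpers

/-- If `G ↷ (X,μ)` is a nonsingular ergodic action of type III₁ (i.e. its
Maharam extension is ergodic) of a countable group, with logarithmic Radon–Nikodym cocycle `ω`,
and `ℝ ↷ (Y,η)` is a nonsingular ergodic flow, then the skew product action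
`g · (x,y) = (g · x, ω(g,x) · y)` on `(X × Y, μ × η)` is ergodic. -/
theorem skew_product_ergodic_of_typeIII1
    {G X Y : Type} [Group G] [Countable G]
    [MeasurableSpace X] [StandardBorelSpace X] (μ : Measure X) [IsProbabilityMeasure μ]
    (a : G → X → X) (ha : IsAction a)
    (hns : Nonsingular μ a) (herg : ErgodicAction μ a)
    (ω : G → X → ℝ) (hω : IsLogRNCocycle μ a ω)
    (hIII1 : ErgodicAction (maharamMeasure μ) (maharamAct a ω))
    [MeasurableSpace Y] [StandardBorelSpace Y] (η : Measure Y) [IsProbabilityMeasure η]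
    (f : ℝ → Y → Y) (hf : IsFlow f) (hfm : Measurable fun p : ℝ × Y => f p.1 p.2)
    (hfns : Nonsingular η f) (hferg : ErgodicAction η f) :
    ErgodicAction (μ.prod η) (fun (g : G) (p : X × Y) => (a g p.1, f (ω g p.1) p.2)) := by
  intro S hSm hS
  have hTm : Measurable fun q : Y × (X × ℝ) => (q.2.1, f q.2.2 q.1) :=
    (by fun_prop : Measurable fun q : Y × (X × ℝ) => q.2.1).prodMk
      (hfm.comp (by fun_prop : Measurable fun q : Y × (X × ℝ) => (q.2.2, q.1)))
  have hai : ∀ g x, a g⁻¹ (a g x) = x := fun g x => by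
    rw [← ha.2, inv_mul_cancel, ha.1]
  have hai' : ∀ g x, a g (a g⁻¹ x) = x := fun g x => by
    rw [← ha.2, mul_inv_cancel, ha.1]
  have hset : ∀ g y, (maharamAct a ω g '' {z : X × ℝ | (z.1, f z.2 y) ∈ S}) =
      {z | (z.1, f z.2 y) ∈ (fun p : X × Y => (a g p.1, f (ω g p.1) p.2)) '' S} := by
    intro g y
    ext ⟨x, s⟩
    constructor
    · rintro ⟨⟨x', s'⟩, hz, he⟩
      simp only [maharamAct, Prod.mk.injEq] at he
      obtain ⟨rfl, rfl⟩ := he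
      exact ⟨(x', f s' y), hz, by simp [hf.2]⟩
    · rintro ⟨⟨x', y'⟩, hz, he⟩
      simp only [Prod.mk.injEq] at he
      obtain ⟨rfl, he⟩ := he
      refine ⟨(x', s - ω g x'), ?_, by simp [maharamAct]⟩
      have : f (s - ω g x') y = y' := by
        rw [sub_eq_add_neg, add_comm, hf.2, ← he, ← hf.2, neg_add_cancel, hf.1]
      simpa [this] using hz
  have hinv : ∀ᵐ y ∂η, ∀ g, maharamMeasure μ
      ((maharamAct a ω g '' {z : X × ℝ | (z.1, f z.2 y) ∈ S}) ∆
        {z : X × ℝ | (z.1, f z.2 y) ∈ S}) = 0 := by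
    rw [ae_all_iff]
    intro g
    have h0 : ∀ᵐ p ∂(μ.prod η), p ∈
        (((fun p : X × Y => (a g p.1, f (ω g p.1) p.2)) '' S) ∆ S)ᶜ := by
      exact compl_mem_ae_iff.2 (hS g)
    filter_upwards [ae_lift μ η f hfm hfns _ h0] with y hy
    rw [← maharam_ae_iff, ae_iff] at hy
    rw [hset]
    convert hy using 2
    ext z
    exact not_not.symm
  have hdich : ∀ᵐ y ∂η, (∀ᵐ z ∂(μ.prod (volume : Measure ℝ)), (z.1, f z.2 y) ∈ Sᶜ) ∨
      (∀ᵐ z ∂(μ.prod (volume : Measure ℝ)), (z.1, f z.2 y) ∈ S) := by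
    filter_upwards [hinv] with y hy
    have hm : MeasurableSet {z : X × ℝ | (z.1, f z.2 y) ∈ S} :=
      (hTm.comp measurable_prodMk_left) hSm
    rcases hIII1 _ hm hy with h | h
    · left
      rw [← maharam_ae_iff, ae_iff]
      simpa using h
    · right
      rw [← maharam_ae_iff, ae_iff]
      exact h
  let B : Set Y := {y | ∀ᵐ z ∂(μ.prod (volume : Measure ℝ)), (z.1, f z.2 y) ∈ S}
  have hBm : MeasurableSet B := by
    have : Measurable fun y => (μ.prod (volume : Measure ℝ))
        (Prod.mk y ⁻¹' {q : Y × (X × ℝ) | (q.2.1, f q.2.2 q.1) ∈ Sᶜ}) :=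
      measurable_measure_prodMk_left (hTm hSm.compl)
    exact this (measurableSet_singleton 0)
  have hBsub : ∀ t y, y ∈ B → f t y ∈ B := by
    intro t y hy
    have := ae_shift μ t _ hy
    show ∀ᵐ z ∂(μ.prod (volume : Measure ℝ)), (z.1, f z.2 (f t y)) ∈ S
    simpa only [hf.2] using this
  have hBinv : ∀ t, η ((f t '' B) ∆ B) = 0 := by
    intro t
    have : f t '' B = B := by
      ext y
      constructor
      · rintro ⟨y, hy, rfl⟩
        exact hBsub t y hy
      · intro hy
        exact ⟨f (-t) y, hBsub _ _ hy, by rw [← hf.2, add_neg_cancel, hf.1]⟩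
    simp [this]
  rcases hferg B hBm hBinv with h | h
  · left
    have hB : ∀ᵐ y ∂η, y ∉ B := by rw [ae_iff]; simpa using h
    have := ae_descend μ η f hfm hfns Sᶜ hSm.compl (by
      filter_upwards [hdich, hB] with y h1 h2
      exact h1.resolve_right h2)
    rw [ae_iff] at this
    simpa using this
  · right
    have := ae_descend μ η f hfm hfns S hSm (by
      have hB : ∀ᵐ y ∂η, y ∈ B := by rw [ae_iff]; exact h
      exact hB)
    rw [ae_iff] at this
    exact this


end OESuperrigidity
end

section
/- Let 𝒜 ⊆ ℝ be a countable subring containing an element that is algebraic over ℚ and does not belong to ℤ, let F be a subgroup of the group of units of 𝒜, and let n ≥ 3. Let Γ = {A ∈ GL(n,ℝ) : all entries of A lie in 𝒜 and det A ∈ F}, and let G = Γ ⋉ 𝒜ⁿ act on ℝⁿ (Lebesgue measure) by (A,a)·x = A(a+x). Then: (i) the action is essentially free; (ii) the action is ergodic; (iii) the action is not induced; and (iv) every normal subgroup Σ of G whose action on ℝⁿ admits a measurable fundamental domain is the trivial subgroup. -/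
open MeasureTheory
open scoped symmDiff

namespace OESuperrigidity

open MeasureTheory

variable (n : ℕ) (A : Subring ℝ)

/-- `Γ = {A ∈ GL(n,𝒜) : det A ∈ F}`, realized as the subgroup of the group of invertible
`n × n` matrices over the ring `𝒜` whose determinant lies in the subgroup `F ⊆ 𝒜ˣ`. -/
def GammaF (F : Subgroup (↥A)ˣ) : Subgroup (Matrix.GeneralLinearGroup (Fin n) ↥A) :=
  F.comap Matrix.GeneralLinearGroup.det

/-- An invertible matrix over `𝒜` acting on `𝒜ⁿ` as an additive automorphism. -/
def mulVecAut (M : Matrix.GeneralLinearGroup (Fin n) ↥A) : AddAut (Fin n → ↥A) where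
  toFun v := (M : Matrix (Fin n) (Fin n) ↥A).mulVec v
  invFun v := ((M⁻¹ : Matrix.GeneralLinearGroup (Fin n) ↥A) :
    Matrix (Fin n) (Fin n) ↥A).mulVec v
  left_inv v := by
    show ((M⁻¹ : Matrix.GeneralLinearGroup (Fin n) ↥A) : Matrix (Fin n) (Fin n) ↥A).mulVec
      ((M : Matrix (Fin n) (Fin n) ↥A).mulVec v) = v
    rw [Matrix.mulVec_mulVec]
    rw [show ((M⁻¹ : Matrix.GeneralLinearGroup (Fin n) ↥A) : Matrix (Fin n) (Fin n) ↥A) *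
      (M : Matrix (Fin n) (Fin n) ↥A) = 1 from M.inv_mul]
    exact Matrix.one_mulVec v
  right_inv v := by
    show (M : Matrix (Fin n) (Fin n) ↥A).mulVec
      (((M⁻¹ : Matrix.GeneralLinearGroup (Fin n) ↥A) : Matrix (Fin n) (Fin n) ↥A).mulVec v) = v
    rw [Matrix.mulVec_mulVec]
    rw [show (M : Matrix (Fin n) (Fin n) ↥A) *
      ((M⁻¹ : Matrix.GeneralLinearGroup (Fin n) ↥A) : Matrix (Fin n) (Fin n) ↥A) = 1
      from M.mul_inv]
    exact Matrix.one_mulVec v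
  map_add' v w := Matrix.mulVec_add _ v w

/-- The action of `Γ` on `𝒜ⁿ` (written multiplicatively), needed to form `Γ ⋉ 𝒜ⁿ`. -/
def gammaAut (F : Subgroup (↥A)ˣ) :
    GammaF n A F →* MulAut (Multiplicative (Fin n → ↥A)) where
  toFun M :=
    { toFun := fun v => Multiplicative.ofAdd (mulVecAut n A (M : Matrix.GeneralLinearGroup (Fin n) ↥A) v.toAdd)
      invFun := fun v => Multiplicative.ofAdd ((mulVecAut n A (M : Matrix.GeneralLinearGroup (Fin n) ↥A)).symm v.toAdd)
      left_inv := fun v => by simp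
      right_inv := fun v => by simp
      map_mul' := fun v w => by
        exact congrArg Multiplicative.ofAdd
          (map_add (mulVecAut n A (M : Matrix.GeneralLinearGroup (Fin n) ↥A)) v.toAdd w.toAdd) }
  map_one' := by
    ext v
    simp [mulVecAut, Matrix.one_mulVec]
  map_mul' M N := by
    ext v
    simp [mulVecAut, Matrix.mulVec_mulVec]

/-- The group `G = Γ ⋉ 𝒜ⁿ`. -/
abbrev AffGroup (F : Subgroup (↥A)ˣ) :=
  SemidirectProduct (Multiplicative (Fin n → ↥A)) (GammaF n A F) (gammaAut n A F)

/-- The affine action of `G = Γ ⋉ 𝒜ⁿ` on `ℝⁿ`: the subgroup `𝒜ⁿ` acts by translations and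
`Γ` acts linearly, so that the transformations of `ℝⁿ` arising from `G` are exactly the maps
`x ↦ A(a + x)` with `A ∈ Γ`, `a ∈ 𝒜ⁿ`. -/
noncomputable def affAct (F : Subgroup (↥A)ˣ) (g : AffGroup n A F) (x : Fin n → ℝ) :
    Fin n → ℝ :=
  (fun i => ((Multiplicative.toAdd g.left) i : ℝ)) +
    (((g.right : Matrix.GeneralLinearGroup (Fin n) ↥A) :
        Matrix (Fin n) (Fin n) ↥A).map (fun r : ↥A => (r : ℝ))).mulVec x


open MeasureTheory

section Helpers

variable {n : ℕ} {A : Subring ℝ} {F : Subgroup (↥A)ˣ}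

open Topology

/-- Steinhaus with a countable set of bad translations. -/
lemma steinhaus_bad {E : Set (Fin n → ℝ)} (hE : MeasurableSet E) (hpos : volume E ≠ 0)
    {D : Set (Fin n → ℝ)} (hD : D.Countable)
    (hnull : ∀ v ∈ D, volume (((fun x => v + x) '' E) ∩ E) = 0) :
    ∃ W ∈ 𝓝 (0 : Fin n → ℝ), ∀ v ∈ D, v ∉ W := by
  have him : ∀ v : Fin n → ℝ, MeasurableSet ((fun x => v + x) '' E) := fun v =>
    (MeasurableEquiv.addLeft v).measurableSet_image.2 hE
  set N : Set (Fin n → ℝ) := ⋃ v ∈ D, (((fun x => v + x) '' E) ∩ E) with hN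
  have hN0 : volume N = 0 := (measure_biUnion_null_iff hD).2 hnull
  have hNm : MeasurableSet N := MeasurableSet.biUnion hD fun v _ => (him v).inter hE
  have hpos' : 0 < volume (E \ N) := by
    rw [measure_sdiff_null hN0]; exact pos_iff_ne_zero.2 hpos
  refine ⟨_, Measure.sub_mem_nhds_zero_of_addHaar_pos volume (E \ N) (hE.diff hNm) hpos', ?_⟩
  rintro v hv ⟨a, ⟨ha, haN⟩, b, ⟨hb, _⟩, hab⟩
  apply haN
  refine Set.mem_biUnion hv ⟨⟨b, hb, ?_⟩, ha⟩
  rw [← hab]; simp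

lemma ergodic_dense {S : Set (Fin n → ℝ)} (hS : MeasurableSet S)
    {D : Set (Fin n → ℝ)} (hD : D.Countable) (hdense : Dense D)
    (hnull : ∀ v ∈ D, volume (((fun x => v + x) '' S) ∩ Sᶜ) = 0) :
    volume S = 0 ∨ volume Sᶜ = 0 := by
  have him : ∀ v : Fin n → ℝ, MeasurableSet ((fun x => v + x) '' S) := fun v =>
    (MeasurableEquiv.addLeft v).measurableSet_image.2 hS
  have key : ∀ v : Fin n → ℝ, volume (((fun x => v + x) '' S) ∩ Sᶜ) = 0 := by
    intro v
    by_contra hv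
    obtain ⟨W, hW, hWD⟩ := steinhaus_bad ((him v).inter hS.compl) hv
      (D := (fun d => d - v) '' D) (hD.image _) (by
        rintro _ ⟨d, hd, rfl⟩
        refine measure_mono_null ?_ (hnull d hd)
        rintro _ ⟨⟨y, ⟨⟨s, hs, rfl⟩, _⟩, rfl⟩, _, h2⟩
        exact ⟨⟨s, hs, by show d + s = d - v + (v + s); abel⟩, h2⟩)
    have hW' : (fun d => d - v) ⁻¹' W ∈ 𝓝 v := by
      have : ContinuousAt (fun d : Fin n → ℝ => d - v) v := by fun_prop
      apply this
      simpa using hW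
    obtain ⟨d, hdW, hd⟩ := mem_closure_iff_nhds.1 (hdense v) _ hW'
    exact hWD _ ⟨d, hd, rfl⟩ hdW
  have hconst : Filter.EventuallyConst S (ae (volume : Measure (Fin n → ℝ))) := by
    refine aeconst_of_forall_preimage_vadd_ae_eq (Fin n → ℝ) hS.nullMeasurableSet ?_
    intro g
    rw [ae_eq_set]
    constructor
    · refine measure_mono_null ?_ (key (-g))
      rintro x ⟨hx, hx'⟩
      exact ⟨⟨g + x, hx, by simp⟩, hx'⟩
    · have h := key g
      rw [← measure_preimage_add volume g] at h
      refine measure_mono_null ?_ h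
      rintro x ⟨hx, hx'⟩
      exact ⟨⟨x, hx, rfl⟩, hx'⟩
  rcases Filter.eventuallyConst_set'.1 hconst with h | h
  · left; exact ae_eq_empty.1 h
  · right; exact ae_eq_univ.1 h

lemma dense_A (hA : ∃ a : ℝ, a ∈ A ∧ a ∉ Set.range (Int.cast : ℤ → ℝ)) :
    Dense (A : Set ℝ) := by
  rcases A.toAddSubgroup.dense_or_cyclic with h | ⟨c, hc⟩
  · exact h
  · exfalso
    have hmem : ∀ x, x ∈ A ↔ ∃ k : ℤ, k • c = x := by
      intro x
      rw [← AddSubgroup.mem_closure_singleton, ← hc]; rfl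
    obtain ⟨a, ha, han⟩ := hA
    obtain ⟨k, hk⟩ := (hmem 1).1 A.one_mem
    have hcA : c ∈ A := (hmem c).2 ⟨1, by simp⟩
    obtain ⟨m, hm⟩ := (hmem (c * c)).1 (A.mul_mem hcA hcA)
    obtain ⟨l, hl⟩ := (hmem a).1 ha
    have hc0 : c ≠ 0 := by rintro rfl; simp at hk
    have : (m : ℝ) = c := by
      rw [zsmul_eq_mul] at hm
      exact mul_right_cancel₀ hc0 hm
    apply han
    exact ⟨l * m, by push_cast; rw [this, ← zsmul_eq_mul, hl]⟩

/-- inclusion of `𝒜ⁿ`. -/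
def incl (v : Fin n → ↥A) : Fin n → ℝ := fun i => (v i : ℝ)

lemma dense_incl (hA : Dense (A : Set ℝ)) :
    Dense (Set.range (incl : (Fin n → ↥A) → (Fin n → ℝ))) := by
  have h : Dense (Set.pi Set.univ fun _ : Fin n => (A : Set ℝ)) :=
    dense_pi _ fun _ _ => hA
  refine h.mono ?_
  intro x hx
  exact ⟨fun i => ⟨x i, hx i (Set.mem_univ _)⟩, rfl⟩

/-- translations. -/
def tr (v : Fin n → ↥A) : AffGroup n A F := SemidirectProduct.inl (Multiplicative.ofAdd v)

lemma affAct_tr (v : Fin n → ↥A) (x : Fin n → ℝ) :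
    affAct n A F (tr v) x = incl v + x := by
  have : ((1 : Matrix (Fin n) (Fin n) ↥A).map (fun r : ↥A => (r : ℝ))) = 1 :=
    Matrix.map_one _ rfl rfl
  simp [affAct, tr, this]
  rfl

lemma affAct_tr_image (v : Fin n → ↥A) (S : Set (Fin n → ℝ)) :
    affAct n A F (tr v) '' S = (fun x => incl v + x) '' S :=
  Set.image_congr fun x _ => affAct_tr v x

lemma affAct_one (x : Fin n → ℝ) : affAct n A F 1 x = x := by
  have : ((1 : Matrix (Fin n) (Fin n) ↥A).map (fun r : ↥A => (r : ℝ))) = 1 :=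
    Matrix.map_one _ rfl rfl
  have h0 : (fun _ : Fin n => (0:ℝ)) = 0 := rfl
  simp [affAct, this, h0]

lemma incl_mulVec (M : Matrix (Fin n) (Fin n) ↥A) (v : Fin n → ↥A) :
    incl (M.mulVec v) = (M.map (fun r : ↥A => (r : ℝ))).mulVec (incl v) := by
  ext i
  simp [incl, Matrix.mulVec, dotProduct]

lemma map_mul_coe (M N : Matrix (Fin n) (Fin n) ↥A) :
    (M * N).map (fun r : ↥A => (r : ℝ)) =
      M.map (fun r : ↥A => (r : ℝ)) * N.map (fun r : ↥A => (r : ℝ)) := by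
  ext i j
  simp [Matrix.mul_apply]

lemma affAct_def (g : AffGroup n A F) (x : Fin n → ℝ) :
    affAct n A F g x = incl (Multiplicative.toAdd g.left) +
    (((g.right : Matrix.GeneralLinearGroup (Fin n) ↥A) :
        Matrix (Fin n) (Fin n) ↥A).map (fun r : ↥A => (r : ℝ))).mulVec x := rfl

lemma affAct_mul (g h : AffGroup n A F) (x : Fin n → ℝ) :
    affAct n A F (g * h) x = affAct n A F g (affAct n A F h x) := by
  have h1 : incl (Multiplicative.toAdd (g * h).left) =
      incl (Multiplicative.toAdd g.left) + incl (((g.right : Matrix.GeneralLinearGroup (Fin n) ↥A) :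
        Matrix (Fin n) (Fin n) ↥A).mulVec (Multiplicative.toAdd h.left)) := by
    ext i; simp [incl, gammaAut, mulVecAut]
  rw [affAct_def, affAct_def g, affAct_def h, h1, Matrix.mulVec_add, incl_mulVec, add_assoc]
  simp [map_mul_coe, Matrix.mulVec_mulVec]

lemma image_null (g : AffGroup n A F) {S : Set (Fin n → ℝ)} (hS : volume S = 0) :
    volume (affAct n A F g '' S) = 0 := by
  have : affAct n A F g '' S = (fun x => incl (Multiplicative.toAdd g.left) + x) ''
      ((Matrix.toLin' (((g.right : Matrix.GeneralLinearGroup (Fin n) ↥A) :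
        Matrix (Fin n) (Fin n) ↥A).map (fun r : ↥A => (r : ℝ)))) '' S) := by
    rw [Set.image_image]
    exact Set.image_congr fun x _ => by rw [affAct_def, Matrix.toLin'_apply]
  rw [this, Set.image_add_left, measure_preimage_add, Measure.addHaar_image_linearMap, hS, mul_zero]

lemma image_mul (g h : AffGroup n A F) (S : Set (Fin n → ℝ)) :
    affAct n A F (g * h) '' S = affAct n A F g '' (affAct n A F h '' S) := by
  rw [Set.image_image]; exact Set.image_congr fun x _ => affAct_mul g h x

lemma image_one (S : Set (Fin n → ℝ)) : affAct n A F 1 '' S = S := by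
  rw [Set.image_congr (fun x _ => affAct_one x)]; simp

lemma countable_aff (hA : Countable A) : Countable (AffGroup n A F) := by
  have h0 : Countable (Matrix (Fin n) (Fin n) ↥A) :=
    inferInstanceAs (Countable (Fin n → Fin n → ↥A))
  have h1 : Countable (Matrix.GeneralLinearGroup (Fin n) ↥A) :=
    (Units.val_injective (α := Matrix (Fin n) (Fin n) ↥A)).countable
  have h2 : Countable (Multiplicative (Fin n → ↥A)) :=
    inferInstanceAs (Countable (Fin n → ↥A))
  exact (SemidirectProduct.equivProd (N := Multiplicative (Fin n → ↥A)) (G := GammaF n A F)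
    (φ := gammaAut n A F)).injective.countable

lemma incl_injective : Function.Injective (incl : (Fin n → ↥A) → (Fin n → ℝ)) := by
  intro v w h
  ext i; exact congrFun h i

lemma ess_free : EssentiallyFree (volume : Measure (Fin n → ℝ)) (affAct n A F) := by
  intro g hg
  set M : Matrix (Fin n) (Fin n) ℝ := (((g.right : Matrix.GeneralLinearGroup (Fin n) ↥A) :
        Matrix (Fin n) (Fin n) ↥A).map (fun r : ↥A => (r : ℝ))) with hM
  set w := incl (Multiplicative.toAdd g.left) with hw
  have hset : {x | affAct n A F g x = x} = {x | w + M.mulVec x = x} := rfl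
  rw [hset]
  by_cases hne : ∃ x0, w + M.mulVec x0 = x0
  · obtain ⟨x0, hx0⟩ := hne
    set L : (Fin n → ℝ) →ₗ[ℝ] (Fin n → ℝ) := Matrix.toLin' M - LinearMap.id with hL
    have hker : L.ker ≠ ⊤ := by
      intro h
      rw [LinearMap.ker_eq_top, sub_eq_zero] at h
      have hM1 : M = 1 := by
        rw [← Matrix.toLin'_one] at h
        exact Matrix.toLin'.injective h
      apply hg
      rw [hM1, Matrix.one_mulVec] at hx0
      have hw0 : w = 0 := by simpa using hx0
      apply SemidirectProduct.ext
      · have : Multiplicative.toAdd g.left = 0 := incl_injective (hw0.trans rfl)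
        exact this
      · apply Subtype.ext
        apply Units.ext
        ext i j
        have := congrFun (congrFun hM1 i) j
        rw [hM] at this
        simp only [Matrix.map_apply] at this
        rw [this]
        by_cases hij : i = j <;> simp [Matrix.one_apply, hij]
    have h0 := Measure.addHaar_submodule volume L.ker hker
    rw [← measure_preimage_add volume (-x0)] at h0
    refine measure_mono_null ?_ h0
    intro x hx
    have hx : w + M.mulVec x = x := hx
    simp only [Set.mem_preimage, SetLike.mem_coe, LinearMap.mem_ker, hL, LinearMap.sub_apply,
      Matrix.toLin'_apply, LinearMap.id_apply, Matrix.mulVec_add, Matrix.mulVec_neg]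
    have e1 : M.mulVec x = x - w := by rw [eq_sub_iff_add_eq, add_comm]; exact hx
    have e2 : M.mulVec x0 = x0 - w := by rw [eq_sub_iff_add_eq, add_comm]; exact hx0
    rw [e1, e2]; abel
  · have : {x | w + M.mulVec x = x} = ∅ := by
      ext x; simp only [Set.mem_ofPred_eq, Set.mem_empty_iff_false, iff_false]
      exact fun h => hne ⟨x, h⟩
    rw [this]; simp

lemma erg (hAc : Countable A) (hA : Dense (A : Set ℝ)) :
    ErgodicAction (volume : Measure (Fin n → ℝ)) (affAct n A F) := by
  intro S hS hinv
  refine ergodic_dense hS (Set.countable_range incl) (dense_incl hA) ?_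
  rintro _ ⟨v, rfl⟩
  refine measure_mono_null ?_ (hinv (tr v))
  rw [affAct_tr_image]
  intro x hx
  exact Or.inl hx

lemma not_induced (hAc : Countable A) (hA : Dense (A : Set ℝ)) :
    ¬ IsInduced (volume : Measure (Fin n → ℝ)) (affAct n A F) := by
  rintro ⟨G₀, hG₀, X₀, hX₀, hpos, hinv, R, hR, hdisj, -⟩
  -- if g X₀ meets X₀ then g ∈ G₀
  have key : ∀ g : AffGroup n A F, volume (affAct n A F g '' X₀ ∩ X₀) ≠ 0 → g ∈ G₀ := by
    intro g hg
    obtain ⟨r, ⟨hrR, hr⟩, -⟩ := hR g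
    obtain ⟨s, ⟨hsR, hs⟩, -⟩ := hR 1
    by_cases hrs : r = s
    · subst hrs
      have : g = ((1:AffGroup n A F)⁻¹ * r) * (g⁻¹ * r)⁻¹ := by group
      rw [this]; exact G₀.mul_mem hs (G₀.inv_mem hr)
    · exfalso
      apply hg
      have hd := hdisj hrR hsR hrs
      have hs : s ∈ G₀ := by simpa using hs
      have h1 := hinv _ hs
      have h2 := image_null g (hinv _ hr)
      have him : affAct n A F g '' ((affAct n A F (g⁻¹ * r) '' X₀) ∆ X₀) ⊇
          affAct n A F g '' X₀ \ affAct n A F r '' X₀ := by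
        rintro _ ⟨⟨x, hx, rfl⟩, hx'⟩
        refine ⟨x, Or.inr ⟨hx, fun hx2 => hx' ?_⟩, rfl⟩
        have : affAct n A F r '' X₀ = affAct n A F g '' (affAct n A F (g⁻¹ * r) '' X₀) := by
          rw [← image_mul]; simp
        rw [this]; exact ⟨x, hx2, rfl⟩
      have h2' := measure_mono_null him h2
      refine measure_mono_null ?_ (measure_union_null (measure_union_null h1 h2') hd)
      rintro x ⟨hx1, hx2⟩
      by_cases ha : x ∈ affAct n A F r '' X₀
      · by_cases hb : x ∈ affAct n A F s '' X₀
        · exact Or.inr ⟨ha, hb⟩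
        · exact Or.inl (Or.inl (Or.inr ⟨hx2, hb⟩))
      · exact Or.inl (Or.inr ⟨hx1, ha⟩)
  obtain ⟨W, hW, hWD⟩ := steinhaus_bad hX₀ hpos.ne'
    (D := {x | ∃ v : Fin n → ↥A, incl v = x ∧ (tr v : AffGroup n A F) ∉ G₀})
    ((Set.countable_range (incl : (Fin n → ↥A) → _)).mono (by rintro _ ⟨v, rfl, -⟩; exact ⟨v, rfl⟩))
    (by
      rintro _ ⟨v, rfl, hv⟩
      by_contra h
      rw [← affAct_tr_image (F := F)] at h
      exact hv (key _ h))
  let K : AddSubgroup (Fin n → ℝ) :=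
    { carrier := {x | ∃ v : Fin n → ↥A, incl v = x ∧ (tr v : AffGroup n A F) ∈ G₀}
      zero_mem' := ⟨0, rfl, by
        have : (tr 0 : AffGroup n A F) = 1 := by simp [tr]
        rw [this]; exact G₀.one_mem⟩
      add_mem' := by
        rintro _ _ ⟨v, rfl, hv⟩ ⟨w, rfl, hw⟩
        refine ⟨v + w, by ext i; simp [incl], ?_⟩
        have : (tr (v + w) : AffGroup n A F) = tr v * tr w := by simp [tr]
        rw [this]; exact G₀.mul_mem hv hw
      neg_mem' := by
        rintro _ ⟨v, rfl, hv⟩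
        refine ⟨-v, by ext i; simp [incl], ?_⟩
        have : (tr (-v) : AffGroup n A F) = (tr v)⁻¹ := by simp [tr]
        rw [this]; exact G₀.inv_mem hv }
  have hKd : Dense (K : Set (Fin n → ℝ)) := by
    have hsub : interior W ⊆ (K.topologicalClosure : Set (Fin n → ℝ)) := by
      refine ((dense_incl hA).open_subset_closure_inter isOpen_interior).trans ?_
      rw [AddSubgroup.topologicalClosure_coe]
      apply closure_mono
      rintro _ ⟨hx, v, rfl⟩
      refine ⟨v, rfl, ?_⟩
      by_contra hv
      exact hWD _ ⟨v, rfl, hv⟩ (interior_subset hx)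
    have hopen : IsOpen (K.topologicalClosure : Set (Fin n → ℝ)) :=
      K.topologicalClosure.isOpen_of_mem_nhds (g := 0)
        (Filter.mem_of_superset (interior_mem_nhds.2 hW) hsub)
    have := (IsClopen.eq_univ ⟨K.isClosed_topologicalClosure, hopen⟩ ⟨0, zero_mem _⟩)
    rw [AddSubgroup.topologicalClosure_coe] at this
    exact dense_iff_closure_eq.2 this
  have hcon : volume X₀ᶜ = 0 := by
    refine (ergodic_dense hX₀ ?_ hKd ?_).resolve_left hpos.ne'
    · exact (Set.countable_range (incl : (Fin n → ↥A) → _)).mono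
        (by rintro _ ⟨v, rfl, -⟩; exact ⟨v, rfl⟩)
    · rintro _ ⟨v, rfl, hv⟩
      refine measure_mono_null ?_ (hinv _ hv)
      rw [affAct_tr_image]
      intro x hx
      exact Or.inl hx
  apply hG₀
  rw [eq_top_iff]
  intro g _
  apply key
  intro h0
  have h1 : volume (affAct n A F g '' X₀) = 0 := by
    refine measure_mono_null ?_ (measure_union_null h0 hcon)
    intro x hx
    by_cases hx' : x ∈ X₀
    · exact Or.inl ⟨hx, hx'⟩
    · exact Or.inr hx'
  have h2 := image_null g⁻¹ h1
  rw [← image_mul, inv_mul_cancel, image_one] at h2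
  exact hpos.ne' h2

/-- transvections as elements of `Γ`. -/
def tv (i j : Fin n) (h : i ≠ j) (c : ↥A) : GammaF n A F :=
  ⟨⟨Matrix.transvection i j c, Matrix.transvection i j (-c),
    by rw [Matrix.transvection_mul_transvection_same _ _ h]; simp,
    by rw [Matrix.transvection_mul_transvection_same _ _ h]; simp⟩, by
    have : Matrix.GeneralLinearGroup.det (⟨Matrix.transvection i j c, Matrix.transvection i j (-c),
      by rw [Matrix.transvection_mul_transvection_same _ _ h]; simp,
      by rw [Matrix.transvection_mul_transvection_same _ _ h]; simp⟩ :
        Matrix.GeneralLinearGroup (Fin n) ↥A) = 1 := by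
      apply Units.ext
      simp [Matrix.det_transvection_of_ne _ _ h]
    show _ ∈ F
    rw [this]; exact F.one_mem⟩

lemma conj_tr (g : AffGroup n A F) (v : Fin n → ↥A) :
    g * tr v * g⁻¹ = tr (((g.right : Matrix.GeneralLinearGroup (Fin n) ↥A) :
        Matrix (Fin n) (Fin n) ↥A).mulVec v) := by
  rw [mul_inv_eq_iff_eq_mul]
  apply SemidirectProduct.ext
  · show g.left * gammaAut n A F g.right (Multiplicative.ofAdd v) =
      Multiplicative.ofAdd (((g.right : Matrix.GeneralLinearGroup (Fin n) ↥A) :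
        Matrix (Fin n) (Fin n) ↥A).mulVec v) * gammaAut n A F 1 g.left
    rw [map_one, mul_comm]
    rfl
  · simp [tr]

lemma simple (hAc : Countable A) (hA : Dense (A : Set ℝ)) (hn : 3 ≤ n)
    (Sig : Subgroup (AffGroup n A F)) (hN : Sig.Normal)
    (hfd : HasFundamentalDomain (volume : Measure (Fin n → ℝ)) (affAct n A F) Sig) :
    Sig = ⊥ := by
  have := countable_aff (n := n) (F := F) hAc
  obtain ⟨U, hU, hdisj, hcov⟩ := hfd
  have hUpos : volume U ≠ 0 := by
    intro h0
    have h1 : volume (⋃ g ∈ Sig, affAct n A F g '' U) = 0 :=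
      (measure_biUnion_null_iff (Set.to_countable (Sig : Set (AffGroup n A F)))).2
        fun g _ => image_null g h0
    have h2 := measure_union_null h1 hcov
    rw [Set.union_compl_self] at h2
    have : (volume : Measure (Fin n → ℝ)) ≠ 0 := NeZero.ne _
    exact this (Measure.measure_univ_eq_zero.1 h2)
  have htr0 : (tr 0 : AffGroup n A F) = 1 := by simp [tr]
  have htrinj : ∀ v : Fin n → ↥A, (tr v : AffGroup n A F) = 1 → v = 0 := by
    intro v hv
    rw [← htr0] at hv
    exact Multiplicative.ofAdd.injective (SemidirectProduct.inl_injective hv)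
  have htrsub : ∀ v w : Fin n → ↥A, (tr (v - w) : AffGroup n A F) = tr v * (tr w)⁻¹ := by
    intro v w; simp [tr, ← map_inv, ← map_mul, div_eq_mul_inv]
  obtain ⟨W, hW, hWD⟩ := steinhaus_bad hU hUpos
    (D := {x | ∃ v : Fin n → ↥A, incl v = x ∧ v ≠ 0 ∧ (tr v : AffGroup n A F) ∈ Sig})
    ((Set.countable_range (incl : (Fin n → ↥A) → _)).mono (by rintro _ ⟨v, rfl, -⟩; exact ⟨v, rfl⟩))
    (by
      rintro _ ⟨v, rfl, hv, hvS⟩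
      have h := hdisj hvS Sig.one_mem (fun h => hv (htrinj v h))
      simp only [image_one, affAct_tr_image] at h
      exact h)
  -- no nonzero translation
  have hnt : ∀ v : Fin n → ↥A, (tr v : AffGroup n A F) ∈ Sig → v = 0 := by
    intro v hv
    by_contra hv0
    obtain ⟨i, hi⟩ := Function.ne_iff.1 hv0
    have : Nontrivial (Fin n) := Fin.nontrivial_iff_two_le.2 (by omega)
    obtain ⟨j, hj⟩ := exists_ne i
    have hcts : Continuous fun r : ℝ => (Pi.single j (r * (v i : ℝ)) : Fin n → ℝ) :=
      (continuous_single j).comp (continuous_id.mul continuous_const)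
    have hW' : (fun r : ℝ => (Pi.single j (r * (v i : ℝ)) : Fin n → ℝ)) ⁻¹' W ∈ 𝓝 (0 : ℝ) := by
      apply hcts.continuousAt
      simpa using hW
    obtain ⟨a, haW, haA, ha0⟩ := mem_closure_iff_nhds.1 ((hA.sdiff_singleton 0) 0) _ hW'
    have hc := Sig.mul_mem (hN.conj_mem _ hv (SemidirectProduct.inr (tv j i hj ⟨a, haA⟩)))
      (Sig.inv_mem hv)
    rw [conj_tr, ← htrsub] at hc
    have hval : ((((SemidirectProduct.inr (tv j i hj ⟨a, haA⟩) : AffGroup n A F).right :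
        Matrix.GeneralLinearGroup (Fin n) ↥A) : Matrix (Fin n) (Fin n) ↥A).mulVec v) - v =
        Pi.single j (⟨a, haA⟩ * v i) := by
      show (Matrix.transvection j i (⟨a, haA⟩ : ↥A)).mulVec v - v = _
      rw [Matrix.transvection, Matrix.add_mulVec, Matrix.one_mulVec, add_sub_cancel_left]
      ext k
      simp [Matrix.single_mulVec, Pi.single_apply, Function.update_apply]
    rw [hval] at hc
    refine hWD _ ⟨_, rfl, ?_, hc⟩ ?_
    · intro h
      have h := congrFun h j
      simp only [Pi.single_eq_same, Pi.zero_apply] at h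
      rcases mul_eq_zero.1 h with h | h
      · exact ha0 (congrArg Subtype.val h)
      · exact hi h
    · have : incl (Pi.single j ((⟨a, haA⟩ : ↥A) * v i)) = (Pi.single j (a * (v i : ℝ)) : Fin n → ℝ) := by
        ext k
        by_cases hk : k = j
        · subst hk; simp [incl]
        · simp [incl, hk]
      rw [this]; exact haW
  rw [eq_bot_iff]
  intro g hg
  rw [Subgroup.mem_bot]
  have hM : ∀ v : Fin n → ↥A, (((g.right : Matrix.GeneralLinearGroup (Fin n) ↥A) :
        Matrix (Fin n) (Fin n) ↥A).mulVec v) = v := by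
    intro v
    have h1 := Sig.mul_mem hg (hN.conj_mem _ (Sig.inv_mem hg) (tr v))
    have h2 : g * (tr v * g⁻¹ * (tr v)⁻¹) = (g * tr v * g⁻¹) * (tr v)⁻¹ := by group
    rw [h2, conj_tr, ← htrsub] at h1
    exact sub_eq_zero.1 (hnt _ h1)
  have hright : g.right = 1 := by
    apply Subtype.ext
    apply Units.ext
    apply Matrix.ext_of_mulVec_single
    intro i
    rw [hM]
    simp only [OneMemClass.coe_one, Units.val_one, Matrix.one_mulVec]
  have hg' : g = tr (Multiplicative.toAdd g.left) := by
    apply SemidirectProduct.ext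
    · simp [tr]
    · simp [tr, hright]
  have := hnt _ (hg' ▸ hg)
  rw [hg', this, htr0]

end Helpers

/-- Let `𝒜 ⊆ ℝ` be a countable subring containing an algebraic number not in
`ℤ`, let `F ⊆ 𝒜ˣ` be a subgroup of the units of `𝒜`, let `n ≥ 3`, and let `G = Γ ⋉ 𝒜ⁿ` where
`Γ = {A ∈ GL(n,𝒜) : det A ∈ F}`, acting on `ℝⁿ` by the affine maps `(A,a)·x = A(a+x)`. Then
this action is (i) essentially free, (ii) ergodic, (iii) not induced, and (iv) every normal
subgroup of `G` whose action admits a measurable fundamental domain is trivial. -/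
theorem affine_action_essentially_free_ergodic_simple
    (A : Subring ℝ) (hAcount : Countable A)
    (hAalg : ∃ a : ℝ, a ∈ A ∧ IsAlgebraic ℚ a ∧ a ∉ Set.range (Int.cast : ℤ → ℝ))
    (F : Subgroup (↥A)ˣ) (n : ℕ) (hn : 3 ≤ n) :
    EssentiallyFree (volume : Measure (Fin n → ℝ)) (affAct n A F) ∧
    ErgodicAction (volume : Measure (Fin n → ℝ)) (affAct n A F) ∧
    ¬ IsInduced (volume : Measure (Fin n → ℝ)) (affAct n A F) ∧
    ∀ Sig : Subgroup (AffGroup n A F), Sig.Normal →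
      HasFundamentalDomain (volume : Measure (Fin n → ℝ)) (affAct n A F) Sig →
      Sig = ⊥ := by
  obtain ⟨a, haA, -, haZ⟩ := hAalg
  have hA : Dense (A : Set ℝ) := dense_A ⟨a, haA, haZ⟩
  exact ⟨ess_free, erg hAcount hA, not_induced hAcount hA, simple hAcount hA hn⟩

end OESuperrigidity
end

section
/- Let 𝒜 ⊆ ℝ be a countable subring containing an element that is algebraic over ℚ and does not belong to ℤ, let F be a subgroup of the group of units of 𝒜, and let n ≥ 3. Let Γ = {A ∈ GL(n,ℝ) : all entries of A lie in 𝒜 and det A ∈ F}, and let G = Γ ⋉ 𝒜ⁿ act on ℝⁿ × ℝ (with the measure λⁿ × λ, λ denoting Lebesgue measure) by (A,a)·(x,s) = (A(a+x), log|det A| + s). Then, up to null sets, the measurable subsets S ⊆ ℝⁿ × ℝ satisfying (λⁿ×λ)((g·S) Δ S) = 0 for all g ∈ G are exactly the sets of the form ℝⁿ × B, where B ⊆ ℝ is measurable and satisfies λ((log|u| + B) Δ B) = 0 for every u ∈ F. -/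
open MeasureTheory
open scoped symmDiff

namespace OESuperrigidity

open MeasureTheory

variable (n : ℕ) (A : Subring ℝ)

open MeasureTheory

/-- The Maharam extension of the affine action: `(A,a)·(x,s) = (A(a+x), log|det A| + s)`. -/
noncomputable def affMaharam (F : Subgroup (↥A)ˣ) (g : AffGroup n A F)
    (p : (Fin n → ℝ) × ℝ) : (Fin n → ℝ) × ℝ :=
  (affAct n A F g p.1,
    Real.log |(((g.right : Matrix.GeneralLinearGroup (Fin n) ↥A) :
      Matrix (Fin n) (Fin n) ↥A).det : ℝ)| + p.2)


theorem erg_aux {n : ℕ} (D : Set (Fin n → ℝ)) (hD : Dense D) (T : Set (Fin n → ℝ))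
    (hT : MeasurableSet T)
    (h : ∀ a ∈ D, (volume : Measure (Fin n → ℝ)) ((fun x => a + x) ⁻¹' T \ T) = 0) :
    (volume : Measure (Fin n → ℝ)) T = 0 ∨ (volume : Measure (Fin n → ℝ)) Tᶜ = 0 := by
  have key : ∀ t : Fin n → ℝ,
      (volume : Measure (Fin n → ℝ)) ((fun x => t + x) ⁻¹' T \ T) = 0 := by
    intro t
    have hU : (fun x => t + x) ⁻¹' T \ T =
        ⋃ m : ℕ, ((fun x => t + x) ⁻¹' (T ∩ Metric.ball 0 m) \ T) := by
      ext x
      simp only [Set.mem_sdiff, Set.mem_preimage, Set.mem_iUnion, Set.mem_inter_iff,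
        Metric.mem_ball, dist_zero_right]
      constructor
      · rintro ⟨h1, h2⟩
        obtain ⟨m, hm⟩ := exists_nat_gt ‖t + x‖
        exact ⟨m, ⟨h1, hm⟩, h2⟩
      · rintro ⟨m, ⟨h1, _⟩, h2⟩
        exact ⟨h1, h2⟩
    rw [hU, measure_iUnion_null_iff]
    intro m
    set K := T ∩ Metric.ball (0 : Fin n → ℝ) m with hK
    have hKm : MeasurableSet K := hT.inter measurableSet_ball
    have hKfin : (volume : Measure (Fin n → ℝ)) K ≠ ⊤ :=
      ((measure_mono Set.inter_subset_right).trans_lt Metric.isBounded_ball.measure_lt_top).ne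
    let f : C((Fin n → ℝ) × (Fin n → ℝ), Fin n → ℝ) := ⟨fun p => p.1 + p.2, by fun_prop⟩
    have hlim := tendsto_measure_symmDiff_preimage_nhds_zero
      (μ := (volume : Measure (Fin n → ℝ))) (ν := volume) (f := fun a => f.curry a)
      (g := f.curry t) (l := nhds t) (s := K) (f.curry.continuous.tendsto t)
      (Filter.Eventually.of_forall fun a => measurePreserving_add_left volume a)
      (measurePreserving_add_left volume t) hKm.nullMeasurableSet hKfin
    by_contra hne
    have hpos : 0 < (volume : Measure (Fin n → ℝ)) ((fun x => t + x) ⁻¹' K \ T) :=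
      pos_iff_ne_zero.mpr hne
    have hev := hlim.eventually (gt_mem_nhds hpos)
    obtain ⟨a, haD, ha⟩ := ((mem_closure_iff_frequently.mp (hD t)).and_eventually hev).exists
    have : (volume : Measure (Fin n → ℝ)) ((fun x => t + x) ⁻¹' K \ T) ≤
        (volume : Measure (Fin n → ℝ)) ((fun x => a + x) ⁻¹' T \ T) +
        (volume : Measure (Fin n → ℝ)) ((f.curry a ⁻¹' K) ∆ (f.curry t ⁻¹' K)) := by
      refine le_trans (measure_mono ?_) (measure_union_le _ _)
      rintro x ⟨h1, h2⟩
      by_cases hx : a + x ∈ K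
      · exact Or.inl ⟨hx.1, h2⟩
      · exact Or.inr (Or.inr ⟨h1, hx⟩)
    rw [h a haD, zero_add] at this
    exact absurd this (not_le.mpr ha)
  have hc : Filter.EventuallyConst T (ae (volume : Measure (Fin n → ℝ))) := by
    refine aeconst_of_forall_preimage_vadd_ae_eq (Fin n → ℝ) hT.nullMeasurableSet fun t => ?_
    rw [← measure_symmDiff_eq_zero_iff, Set.symmDiff_def, measure_union_null_iff]
    refine ⟨key t, ?_⟩
    have e : T \ ((t +ᵥ ·) ⁻¹' T) = (fun x => t + x) ⁻¹' ((fun x => -t + x) ⁻¹' T \ T) := by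
      ext x; simp
    rw [e, measure_preimage_add]
    exact key (-t)
  rcases Filter.eventuallyConst_set.mp hc with h1 | h1
  · right; exact h1
  · left
    have := ae_iff.mp h1
    simpa using this

theorem dense_aux (A : Subring ℝ)
    (h : ∃ a : ℝ, a ∈ A ∧ a ∉ Set.range (Int.cast : ℤ → ℝ)) : Dense (A : Set ℝ) := by
  rcases A.toAddSubgroup.dense_or_cyclic with h1 | ⟨g, hg⟩
  · exact h1
  · exfalso
    have hm : ∀ x : ℝ, x ∈ A ↔ ∃ k : ℤ, k • g = x := by
      intro x
      rw [← AddSubgroup.mem_closure_singleton, ← hg]; rfl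
    obtain ⟨a, ha, hna⟩ := h
    obtain ⟨k, hk⟩ := (hm 1).mp A.one_mem
    have hgA : g ∈ A := (hm g).mpr ⟨1, by simp⟩
    obtain ⟨m, hm2⟩ := (hm (g * g)).mp (A.mul_mem hgA hgA)
    obtain ⟨l, hl⟩ := (hm a).mp ha
    have hg0 : g ≠ 0 := by rintro rfl; simp at hk
    have : g = m := by
      rw [zsmul_eq_mul] at hm2
      exact (mul_right_cancel₀ hg0 hm2).symm
    apply hna
    refine ⟨l * m, ?_⟩
    rw [← hl, this]; simp

theorem slice_null {n : ℕ} {N : Set ((Fin n → ℝ) × ℝ)}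
    (h : (volume : Measure ((Fin n → ℝ) × ℝ)) N = 0) :
    ∀ᵐ s : ℝ, (volume : Measure (Fin n → ℝ)) ((fun x => (x, s)) ⁻¹' N) = 0 := by
  have h2 : ((volume : Measure ℝ).prod (volume : Measure (Fin n → ℝ))) (Prod.swap ⁻¹' N) = 0 := by
    exact (Measure.measurePreserving_swap (μ := (volume : Measure ℝ))
      (ν := (volume : Measure (Fin n → ℝ)))).quasiMeasurePreserving.preimage_null h
  exact Measure.measure_ae_null_of_prod_null h2

theorem prod_slice {n : ℕ} (C : Set ℝ) :
    (volume : Measure ((Fin n → ℝ) × ℝ)) (Set.univ ×ˢ C) = 0 ↔ (volume : Measure ℝ) C = 0 := by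
  rw [Measure.volume_eq_prod, Measure.prod_prod, mul_eq_zero]
  constructor
  · rintro (h | h)
    · exact absurd h (isOpen_univ.measure_pos _ Set.univ_nonempty).ne'
    · exact h
  · exact Or.inr

theorem affMaharam_image_null {n : ℕ} {A : Subring ℝ} {F : Subgroup (↥A)ˣ} (g : AffGroup n A F)
    {N : Set ((Fin n → ℝ) × ℝ)}
    (h : (volume : Measure ((Fin n → ℝ) × ℝ)) N = 0) :
    (volume : Measure ((Fin n → ℝ) × ℝ)) (affMaharam n A F g '' N) = 0 := by
  have : (volume : Measure ((Fin n → ℝ) × ℝ)).IsAddHaarMeasure := by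
    rw [Measure.volume_eq_prod]; infer_instance
  refine addHaar_image_eq_zero_of_differentiableOn_of_addHaar_eq_zero volume ?_ h
  apply Differentiable.differentiableOn
  unfold affMaharam affAct
  refine Differentiable.prodMk (Differentiable.add (by fun_prop) ?_) (by fun_prop)
  have := (Matrix.mulVecLin (((g.right : Matrix.GeneralLinearGroup (Fin n) ↥A) :
        Matrix (Fin n) (Fin n) ↥A).map (fun r : ↥A => (r : ℝ)))).toContinuousLinearMap.differentiable
  exact this.comp differentiable_fst

theorem affAct_bij {n : ℕ} {A : Subring ℝ} {F : Subgroup (↥A)ˣ} (g : AffGroup n A F) :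
    Function.Bijective (affAct n A F g) := by
  have key : ∀ M N : Matrix (Fin n) (Fin n) ↥A, M * N = 1 → ∀ x : Fin n → ℝ,
      (M.map (fun r : ↥A => (r : ℝ))).mulVec ((N.map (fun r : ↥A => (r : ℝ))).mulVec x) = x := by
    intro M N h x
    have h2 : M.map (fun r : ↥A => (r : ℝ)) * N.map (fun r : ↥A => (r : ℝ)) = 1 := by
      have := congrArg (fun X => X.map A.subtype) h
      simp only [Matrix.map_mul] at this
      rw [Matrix.map_one _ (map_zero _) (map_one _)] at this
      exact this
    rw [Matrix.mulVec_mulVec, h2, Matrix.one_mulVec]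
  set M := (g.right : Matrix.GeneralLinearGroup (Fin n) ↥A)
  have k1 := key _ _ M.mul_inv
  have k2 := key _ _ M.inv_mul
  constructor
  · intro x y hxy
    have := add_left_cancel hxy
    rw [← k2 x, ← k2 y]
    exact congrArg _ this
  · intro y
    have := k1 (y - (fun i => ((Multiplicative.toAdd g.left) i : ℝ)))
    refine ⟨_, (congrArg (fun z => (fun i => ((Multiplicative.toAdd g.left) i : ℝ)) + z)
      this).trans ?_⟩
    simp

theorem affMaharam_inj {n : ℕ} {A : Subring ℝ} {F : Subgroup (↥A)ˣ} (g : AffGroup n A F) :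
    Function.Injective (affMaharam n A F g) := by
  rintro ⟨x, s⟩ ⟨y, t⟩ h
  simp only [affMaharam, Prod.mk.injEq, add_right_inj] at h
  exact Prod.ext ((affAct_bij g).1 h.1) h.2

theorem affMaharam_image_prod {n : ℕ} {A : Subring ℝ} {F : Subgroup (↥A)ˣ} (g : AffGroup n A F)
    (B : Set ℝ) : affMaharam n A F g '' (Set.univ ×ˢ B) = Set.univ ×ˢ
      ((fun s => Real.log |(((g.right : Matrix.GeneralLinearGroup (Fin n) ↥A) :
      Matrix (Fin n) (Fin n) ↥A).det : ℝ)| + s) '' B) := by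
  have : affMaharam n A F g = Prod.map (affAct n A F g)
    (fun s => Real.log |(((g.right : Matrix.GeneralLinearGroup (Fin n) ↥A) :
      Matrix (Fin n) (Fin n) ↥A).det : ℝ)| + s) := rfl
  rw [this, Set.prodMap_image_prod, Set.image_univ, (affAct_bij g).2.range_eq]

/-- `S ~ univ × B` implies `g S ~ univ × (c + B)`, hence the two invariances are equivalent. -/
theorem inv_iff {n : ℕ} {A : Subring ℝ} {F : Subgroup (↥A)ˣ} (g : AffGroup n A F)
    (S : Set ((Fin n → ℝ) × ℝ)) (B : Set ℝ)
    (hSB : (volume : Measure ((Fin n → ℝ) × ℝ)) (S ∆ (Set.univ ×ˢ B)) = 0) :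
    (volume : Measure ((Fin n → ℝ) × ℝ)) ((affMaharam n A F g '' S) ∆ S) = 0 ↔
      (volume : Measure ℝ) (((fun s => Real.log |(((g.right :
        Matrix.GeneralLinearGroup (Fin n) ↥A) :
        Matrix (Fin n) (Fin n) ↥A).det : ℝ)| + s) '' B) ∆ B) = 0 := by
  have h1 := affMaharam_image_null g hSB
  rw [Set.image_symmDiff (affMaharam_inj g), affMaharam_image_prod] at h1
  rw [← prod_slice (n := n)]
  rw [measure_symmDiff_eq_zero_iff] at h1 hSB ⊢
  have e : ∀ X Y : Set ℝ, (Set.univ : Set (Fin n → ℝ)) ×ˢ (X ∆ Y)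
      = (Set.univ ×ˢ X) ∆ (Set.univ ×ˢ Y) := by
    intro X Y; ext ⟨x, y⟩; simp [Set.mem_symmDiff]
  rw [e, measure_symmDiff_eq_zero_iff]
  exact ⟨fun h => (h1.symm.trans h).trans hSB, fun h => (h1.trans h).trans hSB.symm⟩

/-- For the Maharam extension `(A,a)·(x,s) = (A(a+x), log|det A| + s)` of the
affine action of `G = Γ ⋉ 𝒜ⁿ` on `ℝⁿ`, the `G`-invariant measurable subsets of `ℝⁿ × ℝ` are,
up to null sets, exactly the sets `ℝⁿ × B` with `B ⊆ ℝ` invariant, up to null sets, under the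
translations by `log|u|` for all `u ∈ F`. -/
theorem affine_maharam_invariant_sets
    (A : Subring ℝ) (hAcount : Countable A)
    (hAalg : ∃ a : ℝ, a ∈ A ∧ IsAlgebraic ℚ a ∧ a ∉ Set.range (Int.cast : ℤ → ℝ))
    (F : Subgroup (↥A)ˣ) (n : ℕ) (hn : 3 ≤ n) :
    ∀ S : Set ((Fin n → ℝ) × ℝ), MeasurableSet S →
      ((∀ g : AffGroup n A F,
          (volume : Measure ((Fin n → ℝ) × ℝ)) ((affMaharam n A F g '' S) ∆ S) = 0) ↔
        ∃ B : Set ℝ, MeasurableSet B ∧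
          (∀ u : (↥A)ˣ, u ∈ F →
            (volume : Measure ℝ)
              (((fun s => Real.log |((u : ↥A) : ℝ)| + s) '' B) ∆ B) = 0) ∧
          (volume : Measure ((Fin n → ℝ) × ℝ)) (S ∆ (Set.univ ×ˢ B)) = 0) := by
  intro S hS
  constructor
  · intro hinv
    have hslice : ∀ᵐ s : ℝ, ∀ a : Fin n → ↥A, (volume : Measure (Fin n → ℝ))
        ((fun x => (fun i => (a i : ℝ)) + x) ⁻¹' ((fun x => (x, s)) ⁻¹' S) \
          ((fun x => (x, s)) ⁻¹' S)) = 0 := by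
      rw [ae_all_iff]
      intro a
      have h0 := slice_null (hinv (SemidirectProduct.inl (Multiplicative.ofAdd (-a))))
      filter_upwards [h0] with s hs
      refine measure_mono_null ?_ hs
      rintro x ⟨hx1, hx2⟩
      refine Or.inl ⟨⟨_, hx1, ?_⟩, hx2⟩
      have hid : (Matrix.map (1 : Matrix (Fin n) (Fin n) ↥A) (fun r : ↥A => (r : ℝ))) = 1 :=
        Matrix.map_one _ rfl rfl
      simp only [affMaharam, affAct, SemidirectProduct.right_inl, SemidirectProduct.left_inl,
        OneMemClass.coe_one, Units.val_one, hid, Matrix.one_mulVec, Matrix.det_one]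
      ext
      · simp
      · simp
    have hdense : Dense (Set.range fun (a : Fin n → ↥A) (i : Fin n) => (a i : ℝ)) := by
      have hA := dense_aux A (hAalg.imp fun a h => ⟨h.1, h.2.2⟩)
      have : DenseRange (fun a : ↥A => (a : ℝ)) := by
        rw [DenseRange]; convert hA; ext x; simp
      exact DenseRange.piMap fun _ => this
    have hdich : ∀ᵐ s : ℝ, (volume : Measure (Fin n → ℝ)) ((fun x => (x, s)) ⁻¹' S) = 0 ∨
        (volume : Measure (Fin n → ℝ)) ((fun x => (x, s)) ⁻¹' S)ᶜ = 0 := by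
      filter_upwards [hslice] with s hs
      refine erg_aux _ hdense _ (measurable_prodMk_right hS) ?_
      rintro _ ⟨a, rfl⟩
      exact hs a
    set B : Set ℝ := {s | (volume : Measure (Fin n → ℝ)) ((fun x => (x, s)) ⁻¹' Sᶜ) = 0} with hB
    have hBm : MeasurableSet B :=
      measurable_measure_prodMk_right hS.compl (measurableSet_singleton 0)
    have hSB : (volume : Measure ((Fin n → ℝ) × ℝ)) (S ∆ (Set.univ ×ˢ B)) = 0 := by
      rw [Measure.volume_eq_prod,
        Measure.prod_apply_symm (hS.symmDiff (MeasurableSet.univ.prod hBm)),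
        lintegral_eq_zero_iff (measurable_measure_prodMk_right
          (hS.symmDiff (MeasurableSet.univ.prod hBm)))]
      filter_upwards [hdich] with s hs
      by_cases hsB : s ∈ B
      · refine measure_mono_null ?_ hsB
        rintro x (⟨hx1, hx2⟩ | ⟨hx1, hx2⟩)
        · exact absurd ⟨Set.mem_univ _, hsB⟩ hx2
        · exact hx2
      · refine measure_mono_null ?_ (hs.resolve_right hsB)
        rintro x (⟨hx1, hx2⟩ | ⟨hx1, hx2⟩)
        · exact hx1
        · exact absurd hx1.2 hsB
    refine ⟨B, hBm, fun u hu => ?_, hSB⟩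
    have hn0 : 0 < n := by omega
    let d : Fin n → (↥A)ˣ := Function.update 1 ⟨0, hn0⟩ u
    have hdet : (Matrix.diagonal fun i => ((d i : (↥A)ˣ) : ↥A)).det = (u : ↥A) := by
      rw [Matrix.det_diagonal, ← Units.coe_prod]
      congr 1
      simp [d, Finset.prod_update_of_mem]
    let M : Matrix.GeneralLinearGroup (Fin n) ↥A :=
      ⟨Matrix.diagonal fun i => ((d i : (↥A)ˣ) : ↥A),
       Matrix.diagonal fun i => (((d i)⁻¹ : (↥A)ˣ) : ↥A),
       by simp [Matrix.diagonal_mul_diagonal], by simp [Matrix.diagonal_mul_diagonal]⟩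
    have hMF : M ∈ GammaF n A F := by
      have : Matrix.GeneralLinearGroup.det M = u := Units.ext hdet
      change Matrix.GeneralLinearGroup.det M ∈ F
      rwa [this]
    have h2 := (inv_iff (SemidirectProduct.inr ⟨M, hMF⟩ : AffGroup n A F) S B hSB).mp (hinv _)
    have h3 : (((SemidirectProduct.inr ⟨M, hMF⟩ : AffGroup n A F).right :
        Matrix.GeneralLinearGroup (Fin n) ↥A) : Matrix (Fin n) (Fin n) ↥A).det = (u : ↥A) := hdet
    rw [h3] at h2
    exact h2
  · rintro ⟨B, hBm, hBinv, hSB⟩ g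
    rw [inv_iff g S B hSB]
    exact hBinv (Matrix.GeneralLinearGroup.det (g.right : Matrix.GeneralLinearGroup (Fin n) ↥A))
      g.right.2

end OESuperrigidity
end

section
/- Let n ≥ 3 be an odd integer and let G be a countable subgroup of SL(n,ℝ) that is dense in SL(n,ℝ). Then the center of G is trivial, and every normal subgroup Σ of G such that the linear action of Σ on ℝⁿ (with Lebesgue measure) admits a measurable fundamental domain is the trivial subgroup. -/
open MeasureTheory
open scoped symmDiff

namespace OESuperrigidity

open MeasureTheory

theorem exists_noncomm {n : ℕ} (hodd : Odd n)
    (G : Subgroup (Matrix.SpecialLinearGroup (Fin n) ℝ))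
    (hdense : ∀ M : Matrix.SpecialLinearGroup (Fin n) ℝ,
      (M : Matrix (Fin n) (Fin n) ℝ) ∈
        closure {x : Matrix (Fin n) (Fin n) ℝ |
          ∃ g ∈ G, (g : Matrix (Fin n) (Fin n) ℝ) = x})
    (s : Matrix.SpecialLinearGroup (Fin n) ℝ) (hs : s ≠ 1)
    (V : Set (Matrix (Fin n) (Fin n) ℝ)) (hV : V ∈ nhds 1) :
    ∃ g ∈ G, (g : Matrix (Fin n) (Fin n) ℝ) ∈ V ∧ g * s ≠ s * g := by
  have h1 : ∃ i j : Fin n, i ≠ j ∧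
      ¬ Commute (Matrix.single i j (1 : ℝ)) (s : Matrix (Fin n) (Fin n) ℝ) := by
    by_contra! hc
    obtain ⟨r, hr⟩ := Matrix.mem_range_scalar_of_commute_single hc
    apply hs
    have hd := s.2
    have hr' : (s : Matrix (Fin n) (Fin n) ℝ) = Matrix.scalar (Fin n) r := hr.symm
    rw [hr'] at hd
    have hp : r ^ n = 1 := by simpa using hd
    have hr1 : r = 1 := hodd.pow_injective (by simpa using hp)
    apply Subtype.ext
    rw [hr', hr1]
    simp
  obtain ⟨i, j, hij, hcomm⟩ := h1
  have hcont : Continuous (fun t : ℝ => Matrix.transvection i j t) := by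
    have : (fun t : ℝ => Matrix.transvection i j t)
        = fun t : ℝ => (1 : Matrix (Fin n) (Fin n) ℝ) + t • Matrix.single i j (1 : ℝ) := by
      funext t
      simp [Matrix.transvection, Matrix.smul_single]
    rw [this]
    fun_prop
  have hVo : interior V ∈ nhds ((fun t : ℝ => Matrix.transvection i j t) 0) := by
    simpa using interior_mem_nhds.2 hV
  have hev := hcont.continuousAt.eventually_mem hVo
  have hev2 : ∀ᶠ t in nhdsWithin (0 : ℝ) {0}ᶜ, Matrix.transvection i j t ∈ interior V :=
    hev.filter_mono nhdsWithin_le_nhds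
  obtain ⟨t, htV, ht0⟩ := (hev2.and self_mem_nhdsWithin).exists
  have ht0 : t ≠ 0 := ht0
  have htc : Matrix.transvection i j t * (s : Matrix (Fin n) (Fin n) ℝ)
      ≠ (s : Matrix (Fin n) (Fin n) ℝ) * Matrix.transvection i j t := by
    intro h
    apply hcomm
    have e : Matrix.single i j (1 : ℝ) = t⁻¹ • (Matrix.transvection i j t - 1) := by
      simp [Matrix.transvection, Matrix.smul_single, ht0]
    rw [e]
    exact (Commute.sub_left h (Commute.one_left _)).smul_left _
  have hW : IsOpen (interior V ∩ {A : Matrix (Fin n) (Fin n) ℝ |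
      A * (s : Matrix (Fin n) (Fin n) ℝ) ≠ (s : Matrix (Fin n) (Fin n) ℝ) * A}) :=
    isOpen_interior.inter (isOpen_ne_fun (by fun_prop) (by fun_prop))
  obtain ⟨A, ⟨hAV, hAc⟩, g, hg, rfl⟩ := mem_closure_iff.1
    (hdense ⟨Matrix.transvection i j t, Matrix.det_transvection_of_ne i j hij t⟩) _ hW ⟨htV, htc⟩
  refine ⟨g, hg, interior_subset hAV, fun h => hAc ?_⟩
  simpa using congrArg (fun x : Matrix.SpecialLinearGroup (Fin n) ℝ =>
    (x : Matrix (Fin n) (Fin n) ℝ)) h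

theorem volume_image_SL {n : ℕ} (s : Matrix.SpecialLinearGroup (Fin n) ℝ) (K : Set (Fin n → ℝ)) :
    volume ((fun x => (s : Matrix (Fin n) (Fin n) ℝ).mulVec x) '' K) = volume K := by
  have := Measure.addHaar_image_linearMap (volume : Measure (Fin n → ℝ))
    (Matrix.toLin' (s : Matrix (Fin n) (Fin n) ℝ)) K
  rw [LinearMap.det_toLin', s.2, abs_one, ENNReal.ofReal_one, one_mul] at this
  exact this

theorem near_one {n : ℕ} (U : Set (Fin n → ℝ)) (hU : MeasurableSet U) (hpos : volume U ≠ 0) :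
    ∃ V ∈ nhds (1 : Matrix (Fin n) (Fin n) ℝ), ∀ s : Matrix.SpecialLinearGroup (Fin n) ℝ,
      (s : Matrix (Fin n) (Fin n) ℝ) ∈ V →
      volume ((fun x => (s : Matrix (Fin n) (Fin n) ℝ).mulVec x) '' U ∩ U) ≠ 0 := by
  obtain ⟨K, hKU, hK, hK0⟩ := hU.exists_lt_isCompact (pos_iff_ne_zero.2 hpos)
  have hKfin : volume K ≠ ⊤ := hK.measure_lt_top.ne
  obtain ⟨O, hKO, hO, hOlt⟩ := K.exists_isOpen_lt_of_lt (volume K + volume K)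
    (ENNReal.lt_add_right hKfin hK0.ne')
  have hev : ∀ᶠ A in nhds (1 : Matrix (Fin n) (Fin n) ℝ), ∀ x ∈ K, A.mulVec x ∈ O := by
    apply hK.eventually_forall_of_forall_eventually
    intro y hy
    have hc : Continuous (fun z : Matrix (Fin n) (Fin n) ℝ × (Fin n → ℝ) => z.1.mulVec z.2) :=
      continuous_fst.matrix_mulVec continuous_snd
    exact hc.continuousAt.eventually_mem (hO.mem_nhds (by simpa using hKO hy))
  refine ⟨_, hev, fun s hs h0 => ?_⟩
  set f := fun x => (s : Matrix (Fin n) (Fin n) ℝ).mulVec x with hf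
  have h0' : volume (f '' K ∩ K) = 0 :=
    measure_mono_null (Set.inter_subset_inter (Set.image_mono hKU) hKU) h0
  have hadd := measure_union_add_inter (μ := volume) (f '' K) hK.measurableSet
  rw [h0', add_zero, volume_image_SL] at hadd
  have hle : volume (f '' K ∪ K) ≤ volume O :=
    measure_mono (Set.union_subset (Set.image_subset_iff.2 hs) hKO)
  rw [hadd] at hle
  exact absurd hOlt (not_lt.2 hle)

/-- Let `n ≥ 3` be odd and let `G` be a countable dense subgroup of
`SL(n,ℝ)`. Then `G` has trivial center, and every normal subgroup of `G` whose linear action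
on `ℝⁿ` admits a measurable fundamental domain is trivial. -/
theorem dense_subgroup_center_trivial_and_no_fundamental_domain
    (n : ℕ) (hn : 3 ≤ n) (hodd : Odd n)
    (G : Subgroup (Matrix.SpecialLinearGroup (Fin n) ℝ)) (hcount : Countable G)
    (hdense : ∀ M : Matrix.SpecialLinearGroup (Fin n) ℝ,
      (M : Matrix (Fin n) (Fin n) ℝ) ∈
        closure {x : Matrix (Fin n) (Fin n) ℝ |
          ∃ g ∈ G, (g : Matrix (Fin n) (Fin n) ℝ) = x}) :
    Subgroup.center G = ⊥ ∧
    ∀ Sig : Subgroup G, Sig.Normal →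
      HasFundamentalDomain (volume : Measure (Fin n → ℝ))
        (fun (g : G) (x : Fin n → ℝ) =>
          ((g : Matrix.SpecialLinearGroup (Fin n) ℝ) : Matrix (Fin n) (Fin n) ℝ).mulVec x)
        Sig →
      Sig = ⊥ := by
  constructor
  · rw [Subgroup.eq_bot_iff_forall]
    intro s hs
    by_contra hne
    obtain ⟨g, hg, -, hgs⟩ := exists_noncomm hodd G hdense s (fun h => hne (Subtype.ext h))
      Set.univ Filter.univ_mem
    exact hgs (congrArg Subtype.val (Subgroup.mem_center_iff.1 hs ⟨g, hg⟩))
  · rintro Sig hN ⟨U, hU, hdisj, hcov⟩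
    rw [Subgroup.eq_bot_iff_forall]
    intro s hs
    by_contra hne
    have hpos : volume U ≠ 0 := by
      intro h0
      have hz : volume (⋃ g ∈ Sig, (fun x : Fin n → ℝ =>
          ((g : Matrix.SpecialLinearGroup (Fin n) ℝ) :
            Matrix (Fin n) (Fin n) ℝ).mulVec x) '' U) = 0 := by
        refine (measure_biUnion_null_iff (Set.to_countable (Sig : Set G))).2 fun g _ => ?_
        rw [volume_image_SL, h0]
      have hall : volume (Set.univ : Set (Fin n → ℝ)) = 0 := by
        rw [← Set.union_compl_self (⋃ g ∈ Sig, (fun x : Fin n → ℝ =>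
          ((g : Matrix.SpecialLinearGroup (Fin n) ℝ) :
            Matrix (Fin n) (Fin n) ℝ).mulVec x) '' U)]
        exact measure_union_null hz hcov
      exact (isOpen_univ.measure_pos volume Set.univ_nonempty).ne' hall
    obtain ⟨V, hV, hVs⟩ := near_one U hU hpos
    let F : Matrix (Fin n) (Fin n) ℝ → Matrix (Fin n) (Fin n) ℝ := fun A =>
      A * ((s : Matrix.SpecialLinearGroup (Fin n) ℝ) : Matrix (Fin n) (Fin n) ℝ) * A.adjugate *
      ((s : Matrix.SpecialLinearGroup (Fin n) ℝ)⁻¹ : Matrix.SpecialLinearGroup (Fin n) ℝ).1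
    have hF : Continuous F := by
      have : Continuous fun A : Matrix (Fin n) (Fin n) ℝ => A.adjugate :=
        continuous_id.matrix_adjugate
      fun_prop
    have hF1 : F 1 = 1 := by
      have : ((s : Matrix.SpecialLinearGroup (Fin n) ℝ) *
        (s : Matrix.SpecialLinearGroup (Fin n) ℝ)⁻¹).1 = 1 := by rw [mul_inv_cancel]; rfl
      simp only [F, Matrix.adjugate_one, one_mul, mul_one]
      exact this
    obtain ⟨g, hg, hgV, hgs⟩ := exists_noncomm hodd G hdense s (fun h => hne (Subtype.ext h))
      (F ⁻¹' V) (hF.continuousAt.preimage_mem_nhds (by rw [hF1]; exact hV))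
    let g' : G := ⟨g, hg⟩
    have hmem : g' * s * g'⁻¹ * s⁻¹ ∈ Sig :=
      Sig.mul_mem (hN.conj_mem s hs g') (Sig.inv_mem hs)
    have hne1 : g' * s * g'⁻¹ * s⁻¹ ≠ 1 := by
      intro h
      apply hgs
      have h2 : g' * s = s * g' := by
        rw [mul_inv_eq_one, mul_inv_eq_iff_eq_mul] at h
        exact h
      exact congrArg Subtype.val h2
    have h0 := hdisj hmem Sig.one_mem hne1
    refine hVs (g * s * g⁻¹ * (s : Matrix.SpecialLinearGroup (Fin n) ℝ)⁻¹) hgV ?_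
    simpa using h0

end OESuperrigidity
end

section
/- Let G be a countable group with a nonsingular ergodic action on a standard probability space (X,μ). Let ℤ₂ denote the compact additive group of 2-adic integers with its Haar probability measure, on which ℤ acts by translation via the canonical embedding ℤ ↪ ℤ₂. Suppose π : X → ℤ₂ is a measurable map whose pushforward π_*μ is equivalent to the Haar measure, and suppose Ω : G × X → ℤ is a measurable 1-cocycle such that for every g ∈ G, π(g·x) = Ω(g,x) + π(x) for μ-a.e. x. If Ω is cohomologous to a group homomorphism δ : G → ℤ, then the action of G on (X,μ) is induced from a proper subgroup of G. -/
open MeasureTheory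
open scoped symmDiff

namespace OESuperrigidity

open MeasureTheory

lemma image_eq {G X : Type} [Group G] {a : G → X → X} (ha : IsAction a) (g : G) (S : Set X) :
    a g '' S = a g⁻¹ ⁻¹' S := by
  ext x
  constructor
  · rintro ⟨y, hy, rfl⟩
    simpa [← ha.2, ha.1] using hy
  · intro hx
    exact ⟨a g⁻¹ x, hx, by simp [← ha.2, ha.1]⟩

lemma image_ae {G X A : Type} [Group G] [MeasurableSpace X] [AddCommGroup A] {μ : Measure X}
    {a : G → X → X} (ha : IsAction a) (d : G →* Multiplicative A) (f : X → A)
    (hf : ∀ g, ∀ᵐ x ∂μ, f (a g x) = (d g).toAdd + f x) (T : Set A) (g : G) :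
    ∀ᵐ x ∂μ, (x ∈ a g '' (f ⁻¹' T) ↔ - (d g).toAdd + f x ∈ T) := by
  filter_upwards [hf g⁻¹] with x hx
  rw [image_eq ha]
  simp [hx]

lemma null_symmDiff {X : Type} [MeasurableSpace X] {μ : Measure X} {S T : Set X}
    (h : ∀ᵐ x ∂μ, (x ∈ S ↔ x ∈ T)) : μ (S ∆ T) = 0 := by
  rw [measure_symmDiff_eq_zero_iff]
  exact h.mono fun x hx => propext hx

lemma key {G X A : Type} [Group G] [Countable G] [MeasurableSpace X] [AddCommGroup A]
    {μ : Measure X} {a : G → X → X} (ha : IsAction a) (herg : ErgodicAction μ a)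
    (d : G →* Multiplicative A) (f : X → A)
    (hf : ∀ g, ∀ᵐ x ∂μ, f (a g x) = (d g).toAdd + f x)
    (hm : ∀ c, MeasurableSet (f ⁻¹' {c})) (c : A) (hc : 0 < μ (f ⁻¹' {c}))
    (hd : ∃ g, d g ≠ 1) : IsInduced μ a := by
  have hmem : ∀ g, ∀ᵐ x ∂μ, (x ∈ a g '' (f ⁻¹' {c}) ↔ f x = (d g).toAdd + c) := by
    intro g
    filter_upwards [image_ae ha d f hf {c} g] with x hx
    rw [hx, Set.mem_singleton_iff, neg_add_eq_iff_eq_add]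
  have hall := ae_all_iff.2 hmem
  refine ⟨d.ker, ?_, f ⁻¹' {c}, hm c, hc, ?_, Set.range (Quotient.out : G ⧸ d.ker → G),
    ?_, ?_, ?_⟩
  · obtain ⟨g, hg⟩ := hd
    intro h
    apply hg
    have : g ∈ d.ker := h ▸ Subgroup.mem_top g
    exact this
  · intro g hg
    apply null_symmDiff
    filter_upwards [hmem g] with x hx
    rw [hx, MonoidHom.mem_ker.1 hg]
    simp
  · intro g
    refine ⟨(QuotientGroup.mk g : G ⧸ d.ker).out, ⟨⟨_, rfl⟩, ?_⟩, ?_⟩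
    · rw [← QuotientGroup.eq]
      exact (Quotient.out_eq' _).symm
    · rintro _ ⟨⟨q, rfl⟩, hq⟩
      rw [← QuotientGroup.eq] at hq
      rw [hq]
      congr 1
      exact (Quotient.out_eq' q).symm
  · rintro _ ⟨q, rfl⟩ _ ⟨q', rfl⟩ hne
    rw [measure_eq_zero_iff_ae_notMem]
    filter_upwards [hall] with x hx
    rintro ⟨h1, h2⟩
    rw [hx] at h1 h2
    apply hne
    have h3 : d q.out = d q'.out := by
      have := h1.symm.trans h2
      exact Multiplicative.toAdd.injective (add_right_cancel this)
    congr 1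
    rw [← Quotient.out_eq' q, ← Quotient.out_eq' q']
    refine QuotientGroup.eq.2 ?_
    rw [MonoidHom.mem_ker, map_mul, map_inv]
    exact inv_mul_eq_one.2 h3
  · let T : Set A := Set.range fun g => (d g).toAdd + c
    have hT : μ (f ⁻¹' T)ᶜ = 0 := by
      have hTm : MeasurableSet (f ⁻¹' T) := by
        have : f ⁻¹' T = ⋃ g, f ⁻¹' {(d g).toAdd + c} := by
          ext x
          simp [T, eq_comm]
        rw [this]
        exact MeasurableSet.iUnion fun g => hm _
      refine (herg _ hTm ?_).resolve_left ?_
      · intro g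
        apply null_symmDiff
        filter_upwards [image_ae ha d f hf T g] with x hx
        rw [hx]
        constructor
        · rintro ⟨k, hk⟩
          refine ⟨g * k, ?_⟩
          simp only at hk
          simp [add_assoc, hk]
        · rintro ⟨k, hk⟩
          refine ⟨g⁻¹ * k, ?_⟩
          simp only at hk
          simp [add_assoc, hk]
      · intro h0
        refine hc.ne' (measure_mono_null ?_ h0)
        intro x hx
        refine ⟨1, ?_⟩
        simpa using (Set.mem_singleton_iff.1 hx).symm
    rw [measure_eq_zero_iff_ae_notMem] at hT ⊢
    filter_upwards [hT, hall] with x h1 hx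
    simp only [Set.mem_compl_iff, not_not] at h1 ⊢
    obtain ⟨g, hg⟩ := h1
    refine Set.mem_biUnion (x := (QuotientGroup.mk g : G ⧸ d.ker).out) ⟨_, rfl⟩ ?_
    rw [hx, ← hg]
    have : g⁻¹ * (QuotientGroup.mk g : G ⧸ d.ker).out ∈ d.ker := by
      rw [← QuotientGroup.eq]
      exact (Quotient.out_eq' _).symm
    rw [MonoidHom.mem_ker, map_mul, map_inv, inv_mul_eq_one] at this
    simp only [this]

lemma haar_singleton [MeasurableSpace ℤ_[2]] [BorelSpace ℤ_[2]]
    (η : Measure ℤ_[2]) [IsProbabilityMeasure η] [η.IsAddHaarMeasure] (z : ℤ_[2]) :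
    η {z} = 0 := by
  by_contra h
  have h1 : η Set.univ = ⊤ := by
    refine Set.Infinite.meas_eq_top Set.infinite_univ ⟨η {z}, h, fun x _ => ?_⟩
    have := measure_preimage_add η (z - x) {z}
    rw [← this]
    apply measure_mono
    intro y hy
    simp only [Set.mem_preimage, Set.mem_singleton_iff] at hy ⊢
    linear_combination hy
  simp at h1

lemma isOpen_fiber (n : ℕ) (c : ZMod (2 ^ n)) :
    IsOpen ((PadicInt.toZModPow (p := 2) n) ⁻¹' {c}) := by
  rw [Metric.isOpen_iff]
  intro z hz
  refine ⟨(2 : ℝ) ^ (-n : ℤ), by positivity, fun w hw => ?_⟩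
  rw [Metric.mem_ball, dist_eq_norm] at hw
  have h1 : w - z ∈ RingHom.ker (PadicInt.toZModPow (p := 2) n) := by
    rw [PadicInt.ker_toZModPow, ← PadicInt.norm_le_pow_iff_mem_span_pow]
    exact_mod_cast hw.le
  rw [RingHom.mem_ker, map_sub, sub_eq_zero] at h1
  exact h1.trans hz

/-- Let `G ↷ (X,μ)` be a nonsingular ergodic action of a countable group and
let `π : X → ℤ₂` be a measurable map to the 2-adic integers whose pushforward is equivalent to
the Haar probability measure, intertwining a measurable `ℤ`-valued cocycle `Ω` with the
translation action `ℤ ↷ ℤ₂`. If `Ω` is cohomologous to a group homomorphism `δ : G → ℤ`, then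
the action `G ↷ (X,μ)` is induced from a proper subgroup. -/
theorem induced_of_integer_cocycle_cohomologous_to_hom
    {G X : Type} [Group G] [Countable G]
    [MeasurableSpace X] [StandardBorelSpace X] (μ : Measure X) [IsProbabilityMeasure μ]
    (a : G → X → X) (ha : IsAction a)
    (hns : Nonsingular μ a) (herg : ErgodicAction μ a)
    [MeasurableSpace ℤ_[2]] [BorelSpace ℤ_[2]]
    (η : Measure ℤ_[2]) [IsProbabilityMeasure η] [η.IsAddHaarMeasure]
    (π : X → ℤ_[2]) (hπ : Measurable π)
    (hπequiv : μ.map π ≪ η ∧ η ≪ μ.map π)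
    (Ω : G → X → ℤ) (hΩmeas : ∀ g, MeasurableDiscrete (Ω g))
    (hΩcoc : ∀ g h : G, ∀ᵐ x ∂μ, Ω (g * h) x = Ω g (a h x) + Ω h x)
    (hπΩ : ∀ g : G, ∀ᵐ x ∂μ, π (a g x) = (Ω g x : ℤ_[2]) + π x)
    (hcohom : ∃ δ : G →* Multiplicative ℤ, ∃ φ : X → ℤ, MeasurableDiscrete φ ∧
      ∀ g : G, ∀ᵐ x ∂μ, Ω g x = -φ (a g x) + Multiplicative.toAdd (δ g) + φ x) :
    IsInduced μ a := by
  obtain ⟨δ, φ, hφ, hδ⟩ := hcohom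
  let ψ : X → ℤ_[2] := fun x => π x + (φ x : ℤ_[2])
  have hψ : ∀ g, ∀ᵐ x ∂μ, ψ (a g x) = (((δ g).toAdd : ℤ) : ℤ_[2]) + ψ x := by
    intro g
    filter_upwards [hπΩ g, hδ g] with x h1 h2
    simp only [ψ, h1, h2]
    push_cast
    ring
  have hpre : ∀ S : Set ℤ_[2], ψ ⁻¹' S =
      ⋃ k : ℤ, {x | φ x = k} ∩ π ⁻¹' ((fun z => z + (k : ℤ_[2])) ⁻¹' S) := by
    intro S
    ext x
    simp [ψ]
  have hψm : Measurable ψ := by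
    intro S hS
    rw [hpre]
    exact MeasurableSet.iUnion fun k => (hφ k).inter (hπ ((measurable_add_const _) hS))
  have hψ0 : ∀ z, μ (ψ ⁻¹' {z}) = 0 := by
    intro z
    rw [hpre, measure_iUnion_null_iff]
    intro k
    refine measure_mono_null Set.inter_subset_right ?_
    have hs : (fun w : ℤ_[2] => w + (k : ℤ_[2])) ⁻¹' {z} = {z - k} := by
      ext w
      simp only [Set.mem_preimage, Set.mem_singleton_iff]
      exact eq_sub_iff_add_eq.symm
    rw [hs, ← Measure.map_apply hπ (measurableSet_singleton _)]
    exact hπequiv.1 (haar_singleton η _)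
  let f : ∀ n : ℕ, X → ZMod (2 ^ n) := fun n x => PadicInt.toZModPow n (ψ x)
  let d : ∀ n : ℕ, G →* Multiplicative (ZMod (2 ^ n)) := fun n =>
    (AddMonoidHom.toMultiplicative (Int.castAddHom (ZMod (2 ^ n)))).comp δ
  have hf : ∀ n g, ∀ᵐ x ∂μ, f n (a g x) = (d n g).toAdd + f n x := by
    intro n g
    filter_upwards [hψ g] with x hx
    simp only [f, hx, map_add, map_intCast]
    rfl
  have hfm : ∀ n c, MeasurableSet (f n ⁻¹' {c}) := by
    intro n c
    have : f n ⁻¹' {c} = ψ ⁻¹' ((PadicInt.toZModPow n) ⁻¹' {c}) := rfl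
    rw [this]
    apply hψm
    exact (isOpen_fiber n c).measurableSet
  have hpos : ∀ n, ∃ c, 0 < μ (f n ⁻¹' {c}) := by
    intro n
    by_contra! hcon
    have hu : μ (⋃ c, f n ⁻¹' {c}) = 0 := by
      have : Countable (ZMod (2 ^ n)) := Finite.to_countable
      exact measure_iUnion_null fun c => le_antisymm (hcon c) bot_le
    have : (⋃ c, f n ⁻¹' {c}) = Set.univ := by
      ext x
      simp
    rw [this] at hu
    simp at hu
  choose c hc using hpos
  by_cases hne : ∃ n g, d n g ≠ 1
  · obtain ⟨n, hg⟩ := hne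
    exact key ha herg (d n) (f n) (hf n) (hfm n) (c n) (hc n) hg
  · exfalso
    push Not at hne
    have hcon : ∀ n, ∀ᵐ x ∂μ, f n x = c n := by
      intro n
      have := (herg _ (hfm n (c n)) ?_).resolve_left (hc n).ne'
      · rw [measure_eq_zero_iff_ae_notMem] at this
        filter_upwards [this] with x hx
        simpa using hx
      · intro g
        apply null_symmDiff
        filter_upwards [image_ae ha (d n) (f n) (hf n) {c n} g] with x hx
        rw [hx, hne]
        simp
    have hall := ae_all_iff.2 hcon
    obtain ⟨y, hy⟩ := hall.exists
    have h1 : ∀ᵐ x ∂μ, x ∈ ψ ⁻¹' {ψ y} := by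
      filter_upwards [hall] with x hx
      refine PadicInt.ext_of_toZModPow.1 fun n => ?_
      exact (hx n).trans (hy n).symm
    have h2 := measure_eq_zero_iff_ae_notMem.1 (hψ0 (ψ y))
    obtain ⟨x, hx1, hx2⟩ := (h1.and h2).exists
    exact hx2 hx1

end OESuperrigidity
end

section
/- Let G be a countable group with a nonsingular ergodic action on a standard probability space (X,μ). Then the action is not induced if and only if for every countable set I equipped with an action of G, every measurable map φ : X → I satisfying, for each g ∈ G, φ(g·x) = g·φ(x) for μ-a.e. x ∈ X, is μ-a.e. equal to a constant. -/
open MeasureTheory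
open scoped symmDiff

namespace OESuperrigidity

open MeasureTheory

theorem mem_image_act {G X : Type*} [Group G] {a : G → X → X} (ha : IsAction a)
    (g : G) (S : Set X) (x : X) : x ∈ a g '' S ↔ a g⁻¹ x ∈ S := by
  constructor
  · rintro ⟨y, hy, rfl⟩
    rw [← ha.2, inv_mul_cancel, ha.1]
    exact hy
  · intro h
    exact ⟨_, h, by rw [← ha.2, mul_inv_cancel, ha.1]⟩

theorem ae_act {G X : Type*} [MeasurableSpace X] {μ : Measure X}
    {a : G → X → X} (hns : Nonsingular μ a) (g : G) {p : X → Prop} (h : ∀ᵐ x ∂μ, p x) :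
    ∀ᵐ x ∂μ, p (a g x) :=
  (Measure.QuasiMeasurePreserving.mk (hns g).1 (hns g).2.1).ae h

theorem symmDiff_null_iff {X : Type*} [MeasurableSpace X] {μ : Measure X} {S T : Set X} :
    μ (S ∆ T) = 0 ↔ ∀ᵐ x ∂μ, (x ∈ S ↔ x ∈ T) := by
  rw [measure_symmDiff_eq_zero_iff, Filter.eventuallyEq_set]

theorem const_of_not_induced
    {G X : Type} [Group G] [Countable G]
    [MeasurableSpace X] (μ : Measure X) [IsProbabilityMeasure μ]
    (a : G → X → X) (ha : IsAction a)
    (hns : Nonsingular μ a) (herg : ErgodicAction μ a) (hni : ¬ IsInduced μ a)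
    (I : Type) [Countable I] (σ : G → I → I) (hσ : IsAction σ)
    (φ : X → I) (hφ : MeasurableDiscrete φ)
    (he : ∀ g : G, ∀ᵐ x ∂μ, φ (a g x) = σ g (φ x)) :
    ∃ c : I, ∀ᵐ x ∂μ, φ x = c := by
  have hpos : ∃ i, μ {x | φ x = i} ≠ 0 := by
    by_contra! h
    have h1 : μ (⋃ i, {x | φ x = i}) = 0 := measure_iUnion_null h
    have h2 : (⋃ i, {x | φ x = i}) = Set.univ := by ext x; simp
    rw [h2] at h1
    simp at h1
  obtain ⟨i, hi⟩ := hpos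
  have hσc : ∀ g j k, σ g⁻¹ j = k ↔ j = σ g k := by
    intro g j k
    constructor
    · rintro rfl
      rw [← hσ.2, mul_inv_cancel, hσ.1]
    · rintro rfl
      rw [← hσ.2, inv_mul_cancel, hσ.1]
  have hset : ∀ g j, ∀ᵐ x ∂μ, (x ∈ a g '' {x | φ x = j} ↔ φ x = σ g j) := by
    intro g j
    filter_upwards [he g⁻¹] with x hx
    rw [mem_image_act ha, Set.mem_ofPred_eq, hx, hσc]
  -- the orbit is conull
  have hcon : ∀ᵐ x ∂μ, ∃ g, φ x = σ g i := by
    have hm : MeasurableSet {x | ∃ g, φ x = σ g i} := by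
      rw [Set.ofPred_exists]
      exact MeasurableSet.iUnion fun g => hφ _
    have hi2 : ∀ g, μ ((a g '' {x | ∃ g, φ x = σ g i}) ∆ {x | ∃ g, φ x = σ g i}) = 0 := by
      intro g
      rw [symmDiff_null_iff]
      filter_upwards [he g⁻¹] with x hx
      rw [mem_image_act ha, Set.mem_ofPred_eq, hx]
      constructor
      · rintro ⟨k, hk⟩
        exact ⟨g * k, by rw [hσ.2, ← hσc, hk]⟩
      · rintro ⟨k, hk⟩
        exact ⟨g⁻¹ * k, by rw [hσ.2, hk]⟩
    rcases herg _ hm hi2 with h | h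
    · exfalso
      refine hi (measure_mono_null ?_ h)
      intro x hx
      exact ⟨1, by rw [hσ.1]; exact hx⟩
    · exact h
  let act : MulAction G I := { smul := σ, one_smul := hσ.1, mul_smul := hσ.2 }
  have hstab : ∀ g, g ∈ MulAction.stabilizer G i ↔ σ g i = i := fun g => Iff.rfl
  have hcos : ∀ g h : G, g⁻¹ * h ∈ MulAction.stabilizer G i ↔ σ g i = σ h i := by
    intro g h
    rw [hstab, hσ.2, hσc, eq_comm]
  by_cases htop : MulAction.stabilizer G i = ⊤
  · refine ⟨i, ?_⟩
    filter_upwards [hcon] with x hx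
    obtain ⟨g, hg⟩ := hx
    rw [hg, ← hstab, htop]
    trivial
  · exfalso
    apply hni
    let R : Set G := Set.range (fun c : G ⧸ MulAction.stabilizer G i => c.out)
    have hout : ∀ g : G, σ g i = σ (QuotientGroup.mk (s := MulAction.stabilizer G i) g).out i := by
      intro g
      rw [← hcos, ← QuotientGroup.eq]
      exact (Quotient.out_eq' _).symm
    have hR : ∀ r ∈ R, ∀ s ∈ R, σ r i = σ s i → r = s := by
      rintro _ ⟨c, rfl⟩ _ ⟨d, rfl⟩ h
      rw [← hcos, ← QuotientGroup.eq] at h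
      have h1 : c = d := by simpa using h
      rw [h1]
    refine ⟨MulAction.stabilizer G i, htop, {x | φ x = i}, hφ i, pos_iff_ne_zero.2 hi, ?_, R,
      ?_, ?_, ?_⟩
    · intro g hg
      rw [symmDiff_null_iff]
      filter_upwards [hset g i] with x hx
      rw [hx, (hstab g).1 hg]
    · intro g
      refine ⟨_, ⟨⟨QuotientGroup.mk g, rfl⟩, (hcos _ _).2 (hout g)⟩, ?_⟩
      rintro y ⟨hy, hy2⟩
      exact hR _ hy _ ⟨_, rfl⟩ (((hcos _ _).1 hy2).symm.trans (hout g))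
    · intro r hr s hs hrs
      have : ∀ᵐ x ∂μ, x ∉ a r '' {x | φ x = i} ∩ a s '' {x | φ x = i} := by
        filter_upwards [hset r i, hset s i] with x h1 h2
        rw [Set.mem_inter_iff, h1, h2]
        rintro ⟨h3, h4⟩
        exact hrs (hR r hr s hs (h3.symm.trans h4))
      exact measure_eq_zero_iff_ae_notMem.2 this
    · have : ∀ᵐ x ∂μ, x ∈ ⋃ r ∈ R, a r '' {x | φ x = i} := by
        filter_upwards [hcon, ae_all_iff.2 fun g => hset g i] with x h1 h2
        obtain ⟨g, hg⟩ := h1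
        rw [Set.mem_iUnion₂]
        exact ⟨_, ⟨QuotientGroup.mk g, rfl⟩, (h2 _).2 (hg.trans (hout g))⟩
      exact this

theorem not_induced_of_const
    {G X : Type} [Group G] [Countable G]
    [MeasurableSpace X] (μ : Measure X) [IsProbabilityMeasure μ]
    (a : G → X → X) (ha : IsAction a) (hns : Nonsingular μ a)
    (hc : ∀ (I : Type) [Countable I], ∀ σ : G → I → I, IsAction σ →
        ∀ φ : X → I, MeasurableDiscrete φ →
          (∀ g : G, ∀ᵐ x ∂μ, φ (a g x) = σ g (φ x)) →
          ∃ c : I, ∀ᵐ x ∂μ, φ x = c) : ¬ IsInduced μ a := by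
  classical
  rintro ⟨G₀, htop, X₀, hm, -, hinv, R, hR, hdis, hcov⟩
  have hcount : Countable (G ⧸ G₀) :=
    (QuotientGroup.mk_surjective (s := G₀)).countable
  have hrep : ∀ c : G ⧸ G₀, ∃ r ∈ R, (QuotientGroup.mk r : G ⧸ G₀) = c := by
    intro c
    induction c using QuotientGroup.induction_on with
    | H g =>
      obtain ⟨r, ⟨hr, hr2⟩, -⟩ := hR g
      exact ⟨r, hr, (QuotientGroup.eq.2 hr2).symm⟩
  choose rep hrepR hrepc using hrep
  have huniq : ∀ r ∈ R, rep (QuotientGroup.mk r) = r := by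
    intro r hr
    refine (hR r).unique ⟨hrepR _, ?_⟩ ⟨hr, by simp [G₀.one_mem]⟩
    exact QuotientGroup.eq.1 (hrepc _).symm
  let F : G ⧸ G₀ → Set X := fun c => {x | a (rep c)⁻¹ x ∈ X₀}
  have hFm : ∀ c, MeasurableSet (F c) := fun c => (hns _).1 hm
  -- translates agree with the representative sets
  have h1 : ∀ᵐ x ∂μ, ∀ g : G, (a g⁻¹ x ∈ X₀ ↔ x ∈ F (QuotientGroup.mk g)) := by
    rw [ae_all_iff]
    intro g
    have hk := hinv _ (QuotientGroup.eq.1 (hrepc (QuotientGroup.mk g)).symm)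
    rw [symmDiff_null_iff] at hk
    filter_upwards [ae_act hns g⁻¹ hk] with x hx
    rw [← hx, mem_image_act ha, ← ha.2]
    simp [F]
  have h2 : ∀ᵐ x ∂μ, ∀ c d, c ≠ d → x ∈ F c → x ∉ F d := by
    rw [ae_all_iff]
    intro c
    rw [ae_all_iff]
    intro d
    by_cases hcd : c = d
    · simp [hcd]
    have hne : rep c ≠ rep d := fun h => hcd (by rw [← hrepc c, ← hrepc d, h])
    have := measure_eq_zero_iff_ae_notMem.1 (hdis (hrepR c) (hrepR d) hne)
    filter_upwards [this] with x hx _ h3 h4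
    exact hx ⟨(mem_image_act ha _ _ _).2 h3, (mem_image_act ha _ _ _).2 h4⟩
  have h3 : ∀ᵐ x ∂μ, ∃ c, x ∈ F c := by
    have : ∀ᵐ x ∂μ, x ∈ ⋃ r ∈ R, a r '' X₀ := hcov
    filter_upwards [this] with x hx
    rw [Set.mem_iUnion₂] at hx
    obtain ⟨r, hr, hx⟩ := hx
    refine ⟨QuotientGroup.mk r, ?_⟩
    change a (rep _)⁻¹ x ∈ X₀
    rw [huniq r hr]
    exact (mem_image_act ha _ _ _).1 hx
  let P : G ⧸ G₀ → X → Prop := fun c x => x ∈ F c ∧ ∀ d, d ≠ c → x ∉ F d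
  have hPm : ∀ c, MeasurableSet {x | P c x} := by
    intro c
    have : {x | P c x} = F c ∩ ⋂ d, ⋂ (_ : d ≠ c), (F d)ᶜ := by
      ext x; simp [P]
    rw [this]
    exact (hFm c).inter (MeasurableSet.iInter fun d => MeasurableSet.iInter fun _ => (hFm d).compl)
  have hPu : ∀ x c d, P c x → P d x → c = d := by
    intro x c d hc hd
    by_contra h
    exact hd.2 c h hc.1
  let φ : X → G ⧸ G₀ := fun x => if h : ∃ c, P c x then h.choose else QuotientGroup.mk 1
  have hφP : ∀ x c, P c x → φ x = c := by
    intro x c h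
    have hex : ∃ c, P c x := ⟨c, h⟩
    simp only [φ, dif_pos hex]
    exact hPu x _ _ hex.choose_spec h
  have hφm : MeasurableDiscrete φ := by
    intro l
    have : {x | φ x = l} = {x | P l x} ∪
        ({_x | QuotientGroup.mk 1 = l} ∩ (⋃ c, {x | P c x})ᶜ) := by
      ext x
      by_cases hex : ∃ c, P c x
      · obtain ⟨c, hx⟩ := hex
        have e := hφP x c hx
        have : x ∈ ⋃ c, {x | P c x} := Set.mem_iUnion.2 ⟨c, hx⟩
        simp only [Set.mem_ofPred_eq, Set.mem_union, Set.mem_inter_iff, Set.mem_compl_iff, this,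
          not_true_eq_false, and_false, or_false, e]
        exact ⟨fun h => h ▸ hx, fun h => hPu x _ _ hx h⟩
      · have e : φ x = QuotientGroup.mk 1 := by simp only [φ, dif_neg hex]
        have : x ∉ ⋃ c, {x | P c x} := fun h => hex (Set.mem_iUnion.1 h)
        have h' : ¬ P l x := fun h => hex ⟨l, h⟩
        simp only [Set.mem_ofPred_eq, Set.mem_union, Set.mem_inter_iff, Set.mem_compl_iff, this,
          not_false_eq_true, and_true, e, h', false_or]
    rw [this]
    exact (hPm l).union ((MeasurableSet.const _).inter (MeasurableSet.iUnion hPm).compl)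
  have hgood : ∀ᵐ x ∂μ, ∀ c, x ∈ F c → φ x = c := by
    filter_upwards [h2] with x hx c hc
    exact hφP x c ⟨hc, fun d hd hxd => hx c d hd.symm hc hxd⟩
  have heq : ∀ g : G, ∀ᵐ x ∂μ, φ (a g x) = g • φ x := by
    intro g
    filter_upwards [hgood, h3, ae_act hns g hgood, ae_act hns g h1] with x e1 e2 e3 e4
    obtain ⟨c, hx⟩ := e2
    rw [e1 c hx]
    apply e3
    have : g • c = QuotientGroup.mk (g * rep c) := by
      conv_lhs => rw [← hrepc c]
      rfl
    rw [this, ← e4, ← ha.2]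
    simpa [F] using hx
  obtain ⟨c, hcc⟩ := hc (G ⧸ G₀) (fun g c => g • c) ⟨one_smul _, mul_smul⟩ φ hφm heq
  have hfix : ∀ g : G, g • c = c := by
    intro g
    have : ∀ᵐ x ∂μ, g • c = c := by
      filter_upwards [hcc, ae_act hns g hcc, heq g] with x e1 e2 e3
      rw [e1, e2] at e3
      exact e3.symm
    exact this.exists.choose_spec
  apply htop
  rw [eq_top_iff]
  intro g _
  induction c using QuotientGroup.induction_on with
  | H k =>
    have := hfix (k * g * k⁻¹)
    have h' : (QuotientGroup.mk (k * g * k⁻¹ * k) : G ⧸ G₀) = QuotientGroup.mk k := this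
    have h'' := QuotientGroup.eq.1 h'.symm
    simpa [mul_assoc] using h''

/-- A nonsingular ergodic action of a countable group is not induced if and
only if every measurable equivariant map into a countable `G`-set is a.e. constant. -/
theorem not_induced_iff_equivariant_maps_constant
    {G X : Type} [Group G] [Countable G]
    [MeasurableSpace X] [StandardBorelSpace X] (μ : Measure X) [IsProbabilityMeasure μ]
    (a : G → X → X) (ha : IsAction a)
    (hns : Nonsingular μ a) (herg : ErgodicAction μ a) :
    ¬ IsInduced μ a ↔
      ∀ (I : Type) [Countable I], ∀ σ : G → I → I, IsAction σ →
        ∀ φ : X → I, MeasurableDiscrete φ →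
          (∀ g : G, ∀ᵐ x ∂μ, φ (a g x) = σ g (φ x)) →
          ∃ c : I, ∀ᵐ x ∂μ, φ x = c :=
  ⟨fun h I _ σ hσ φ hφ he => const_of_not_induced μ a ha hns herg h I σ hσ φ hφ he,
    fun h => not_induced_of_const μ a ha hns h⟩

end OESuperrigidity
end
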